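/- arXiv:2012.06288 — 2 statements merged into one kernel-verified Lean document; each statement's English description precedes it below -/
import Mathlib

section
/- Let G be a 3-connected finite simple graph and let C be a non-interleaved cycle in G. Then the inequality ∑_{e ∈ E(C)} x_e ≤ 2 is facet-defining for BOND(G). -/
open Finset

namespace BondPolytope

variable {V : Type*}

/-- The cut `δ(S)`: edges of `G` with exactly one endpoint in `S`. -/
def cut (G : SimpleGraph V) (S : Set V) : Set (Sym2 V) :=
  {e | e ∈ G.edgeSet ∧ ∃ u w, e = s(u, w) ∧ u ∈ S ∧ w ∉ S}

/-- A set of edges is a cut of `G`. -/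
def IsCut (G : SimpleGraph V) (D : Set (Sym2 V)) : Prop :=
  ∃ S : Set V, D = cut G S

/-- A set of edges is a bond of `G`: it is a cut `δ(S)` such that both sides induce
connected (possibly empty) subgraphs. -/
def IsBond (G : SimpleGraph V) (D : Set (Sym2 V)) : Prop :=
  ∃ S : Set V, D = cut G S ∧ (G.induce S).Preconnected ∧ (G.induce Sᶜ).Preconnected

open Classical in
/-- The indicator vector `x^δ ∈ ℝ^E` of a set `δ` of edges. -/
noncomputable def indVec (G : SimpleGraph V) (D : Set (Sym2 V)) : ↥G.edgeSet → ℝ :=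
  fun e => if (e : Sym2 V) ∈ D then 1 else 0

/-- The bond polytope `BOND(G) ⊆ ℝ^E`. -/
noncomputable def bondPolytope (G : SimpleGraph V) : Set (↥G.edgeSet → ℝ) :=
  convexHull ℝ {x | ∃ D, IsBond G D ∧ x = indVec G D}

/-- The cut polytope `CUT(G) ⊆ ℝ^E`. -/
noncomputable def cutPolytope (G : SimpleGraph V) : Set (↥G.edgeSet → ℝ) :=
  convexHull ℝ {x | ∃ D, IsCut G D ∧ x = indVec G D}

/-- `a^T x`. -/
noncomputable def dot {ι : Type*} [Fintype ι] (a x : ι → ℝ) : ℝ := ∑ i, a i * x i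

/-- Affine dimension of a set of points. -/
noncomputable def affDim {W : Type*} [AddCommGroup W] [Module ℝ W] (s : Set W) : ℕ :=
  Module.finrank ℝ ↥(vectorSpan ℝ s)

/-- `a^T x ≤ b` is facet-defining for `P`. -/
def IsFacet {ι : Type*} [Fintype ι] (P : Set (ι → ℝ)) (a : ι → ℝ) (b : ℝ) : Prop :=
  a ≠ 0 ∧ (∀ x ∈ P, dot a x ≤ b) ∧ {x ∈ P | dot a x = b}.Nonempty ∧
    affDim {x ∈ P | dot a x = b} + 1 = affDim P


/-- The cycle given by the closed walk `c` is interleaved: there are four vertices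
appearing in this cyclic order along `c` that are connected crosswise by two
vertex-disjoint paths in `G - E(c)`. -/
def IsInterleaved (G : SimpleGraph V) {v : V} (c : G.Walk v v) : Prop :=
  ∃ i₁ i₂ i₃ i₄ : ℕ, i₁ < i₂ ∧ i₂ < i₃ ∧ i₃ < i₄ ∧ i₄ < c.length ∧
    ∃ (q₁ : (G.deleteEdges {e | e ∈ c.edges}).Walk (c.getVert i₁) (c.getVert i₃))
      (q₂ : (G.deleteEdges {e | e ∈ c.edges}).Walk (c.getVert i₂) (c.getVert i₄)),
      q₁.IsPath ∧ q₂.IsPath ∧ ∀ x ∈ q₁.support, x ∉ q₂.support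

/-- `G` is 3-connected: it has at least 4 vertices and deleting any at most 2 vertices
leaves it connected. -/
def ThreeConnected {V : Type*} [Fintype V] (G : SimpleGraph V) : Prop :=
  4 ≤ Fintype.card V ∧ ∀ W : Set V, W.ncard ≤ 2 → (G.induce (Wᶜ : Set V)).Connected

section Linked

variable {V : Type*} {G H : SimpleGraph V} {S T : Set V} {u v w : V}

/-- `u` and `v` are joined by a walk of `G` all of whose vertices lie in `S`. -/
def Linked (G : SimpleGraph V) (S : Set V) (u v : V) : Prop :=
  ∃ p : G.Walk u v, ∀ w ∈ p.support, w ∈ S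

/-- Any two vertices of `S` are joined inside `S`. -/
def LinkedSet (G : SimpleGraph V) (S : Set V) : Prop :=
  ∀ u ∈ S, ∀ v ∈ S, Linked G S u v

lemma Linked.refl (h : u ∈ S) : Linked G S u u :=
  ⟨.nil, by simpa using h⟩

lemma Linked.symm (h : Linked G S u v) : Linked G S v u := by
  obtain ⟨p, hp⟩ := h
  exact ⟨p.reverse, by simpa using hp⟩

lemma Linked.trans (h : Linked G S u v) (h' : Linked G S v w) : Linked G S u w := by
  obtain ⟨p, hp⟩ := h
  obtain ⟨q, hq⟩ := h'
  refine ⟨p.append q, fun x hx => ?_⟩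
  rw [SimpleGraph.Walk.mem_support_append_iff] at hx
  exact hx.elim (hp x) (hq x)

lemma Linked.mono (hST : S ⊆ T) (h : Linked G S u v) : Linked G T u v := by
  obtain ⟨p, hp⟩ := h
  exact ⟨p, fun x hx => hST (hp x hx)⟩

lemma Linked.mono_graph (hGH : G ≤ H) (h : Linked G S u v) : Linked H S u v := by
  obtain ⟨p, hp⟩ := h
  exact ⟨p.mapLe hGH, by simpa using hp⟩

lemma Linked.mem_left (h : Linked G S u v) : u ∈ S := by
  obtain ⟨p, hp⟩ := h
  exact hp _ p.start_mem_support

lemma Linked.mem_right (h : Linked G S u v) : v ∈ S := h.symm.mem_left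

lemma Linked.of_adj (h : G.Adj u v) (hu : u ∈ S) (hv : v ∈ S) : Linked G S u v :=
  ⟨h.toWalk, by simp [hu, hv]⟩

lemma Linked.tail (h : Linked G S u v) (hvw : G.Adj v w) (hw : w ∈ S) : Linked G S u w :=
  h.trans (.of_adj hvw h.mem_right hw)

lemma Linked.induction {P : V → Prop} (h : Linked G S u v) (hu : P u)
    (step : ∀ a b, a ∈ S → b ∈ S → G.Adj a b → P a → P b) : P v := by
  obtain ⟨p, hp⟩ := h
  induction p with
  | nil => exact hu
  | cons hadj q ih =>
    refine ih (step _ _ (hp _ (by simp)) (hp _ (by simp)) hadj hu) fun x hx => hp x (by simp [hx])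

/-- A walk leaving `P` crosses its boundary. -/
lemma Linked.exists_exit {P : V → Prop} (h : Linked G S u v) (hu : P u) (hv : ¬ P v) :
    ∃ a b, a ∈ S ∧ b ∈ S ∧ G.Adj a b ∧ P a ∧ ¬ P b := by
  by_contra! hcon
  exact hv (h.induction hu hcon)

lemma linkedSet_iff_preconnected : LinkedSet G S ↔ (G.induce S).Preconnected := by
  constructor
  · rintro h ⟨u, hu⟩ ⟨v, hv⟩
    obtain ⟨p, hp⟩ := h u hu v hv
    exact ⟨p.induce S hp⟩
  · intro h u hu v hv
    obtain ⟨p⟩ := h ⟨u, hu⟩ ⟨v, hv⟩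
    refine ⟨p.map (SimpleGraph.Embedding.induce S).toHom, fun x hx => ?_⟩
    have hx' : x ∈ (p.map (SimpleGraph.Embedding.induce S).toHom).support := hx
    rw [SimpleGraph.Walk.support_map, List.mem_map] at hx'
    obtain ⟨y, -, rfl⟩ := hx'
    exact y.2

lemma linkedSet_of_root (r : V) (h : ∀ u ∈ S, Linked G S r u) : LinkedSet G S :=
  fun u hu v hv => (h u hu).symm.trans (h v hv)

lemma linkedSet_singleton (u : V) : LinkedSet G {u} := by
  rintro _ rfl _ rfl
  exact .refl rfl

lemma LinkedSet.union (hS : LinkedSet G S) (hT : LinkedSet G T) (hu : u ∈ S) (hv : v ∈ T)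
    (huv : G.Adj u v) : LinkedSet G (S ∪ T) := by
  refine linkedSet_of_root u fun w hw => ?_
  rcases hw with hw | hw
  · exact (hS u hu w hw).mono Set.subset_union_left
  · exact (Linked.of_adj huv (Or.inl hu) (Or.inr hv)).trans
      ((hT v hv w hw).mono Set.subset_union_right)

lemma LinkedSet.insert {S : Set V} {u v : V} (hS : LinkedSet G S) (hu : u ∈ S)
    (huv : G.Adj u v) : LinkedSet G (insert v S) := by
  rw [Set.insert_eq, Set.union_comm]
  exact hS.union (linkedSet_singleton v) hu rfl huv

end Linked

section Menger

variable {V : Type*} {G H : SimpleGraph V} {A B P : Set V} {a b : V}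

/-- `P` is the vertex set of a path of `G` from `a` to `b` meeting `A` only in `a`
and `B` only in `b`. -/
structure IsThread (G : SimpleGraph V) (A B P : Set V) (a b : V) : Prop where
  start_mem : a ∈ P
  end_mem : b ∈ P
  start_mem' : a ∈ A
  end_mem' : b ∈ B
  eq_start : ∀ v ∈ P, v ∈ A → v = a
  eq_end : ∀ v ∈ P, v ∈ B → v = b
  linked : ∀ v ∈ P, Linked G P a v
  linked_start : ∀ v ∈ P, v ≠ b → Linked G (P \ {b}) a v
  linked_end : ∀ v ∈ P, v ≠ a → Linked G (P \ {a}) v b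

lemma IsThread.symm (h : IsThread G A B P a b) : IsThread G B A P b a where
  start_mem := h.end_mem
  end_mem := h.start_mem
  start_mem' := h.end_mem'
  end_mem' := h.start_mem'
  eq_start := h.eq_end
  eq_end := h.eq_start
  linked v hv := (h.linked b h.end_mem).symm.trans (h.linked v hv)
  linked_start v hv hva := (h.linked_end v hv hva).symm
  linked_end v hv hvb := (h.linked_start v hv hvb).symm

/-- A walk from `A` to `B` contains a thread from `A` to `B`. -/
lemma Linked.exists_isThread {S : Set V} (h : Linked G S a b) (ha : a ∈ A) (hb : b ∈ B) :
    ∃ P ⊆ S, ∃ a' b', IsThread G A B P a' b' := by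
  classical
  have hex : ∃ n, ∃ a' ∈ A, ∃ b' ∈ B, ∃ p : G.Walk a' b', (∀ x ∈ p.support, x ∈ S) ∧
      p.length = n := by
    obtain ⟨p, hp⟩ := h
    exact ⟨_, a, ha, b, hb, p, hp, rfl⟩
  obtain ⟨a', ha', b', hb', p, hpS, hpn⟩ := Nat.find_spec hex
  have hmin : ∀ {a'' b'' : V} (q : G.Walk a'' b''), a'' ∈ A → b'' ∈ B →
      (∀ x ∈ q.support, x ∈ p.support) → p.length ≤ q.length := by
    intro a'' b'' q ha'' hb'' hq
    rw [hpn]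
    exact Nat.find_min' hex ⟨a'', ha'', b'', hb'', q, fun x hx => hpS x (hq x hx), rfl⟩
  have hlast : ∀ v (hv : v ∈ p.support), v ≠ b' → b' ∉ (p.takeUntil v hv).support := by
    intro v hv hvb hmem
    have h1 := hmin ((p.takeUntil v hv).takeUntil b' hmem) ha' hb' fun x hx =>
      p.support_takeUntil_subset_support hv
        ((p.takeUntil v hv).support_takeUntil_subset_support hmem hx)
    have h2 := SimpleGraph.Walk.length_takeUntil_lt_length hv hvb
    have h3 := (p.takeUntil v hv).length_takeUntil_le_length hmem
    omega
  have hfirst : ∀ v (hv : v ∈ p.support), v ≠ a' → a' ∉ (p.dropUntil v hv).support := by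
    intro v hv hva hmem
    have h1 := hmin ((p.dropUntil v hv).dropUntil a' hmem) ha' hb' fun x hx =>
      p.support_dropUntil_subset_support hv
        ((p.dropUntil v hv).support_dropUntil_subset_support hmem hx)
    have h2 := SimpleGraph.Walk.length_dropUntil_lt_length hv hva
    have h3 := (p.dropUntil v hv).length_dropUntil_le_length hmem
    omega
  refine ⟨{x | x ∈ p.support}, hpS, a', b', p.start_mem_support, p.end_mem_support, ha', hb',
    ?_, ?_, ?_, ?_, ?_⟩
  · intro v hv hvA
    by_contra hva
    have h1 := hmin (p.dropUntil v hv) hvA hb' (p.support_dropUntil_subset_support hv)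
    have h2 := SimpleGraph.Walk.length_dropUntil_lt_length hv hva
    omega
  · intro v hv hvB
    by_contra hvb
    have h1 := hmin (p.takeUntil v hv) ha' hvB (p.support_takeUntil_subset_support hv)
    have h2 := SimpleGraph.Walk.length_takeUntil_lt_length hv hvb
    omega
  · intro v hv
    exact ⟨p.takeUntil v hv, fun x hx => p.support_takeUntil_subset_support hv hx⟩
  · intro v hv hvb
    refine ⟨p.takeUntil v hv, fun x hx => ⟨p.support_takeUntil_subset_support hv hx, ?_⟩⟩
    rintro rfl
    exact hlast v hv hvb hx
  · intro v hv hva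
    refine ⟨p.dropUntil v hv, fun x hx => ⟨p.support_dropUntil_subset_support hv hx, ?_⟩⟩
    rintro rfl
    exact hfirst v hv hva hx

lemma IsThread.mono_graph (hGH : G ≤ H) (h : IsThread G A B P a b) : IsThread H A B P a b where
  __ := h
  linked v hv := (h.linked v hv).mono_graph hGH
  linked_start v hv hvb := (h.linked_start v hv hvb).mono_graph hGH
  linked_end v hv hva := (h.linked_end v hv hva).mono_graph hGH

/-- One half of the inductive step of Menger's theorem: after deleting the edge `xy`, the set
`insert x X` is still hard to separate from `A`. -/
lemma exists_linked_insert_of_deleteEdges {X Z : Set V} {x y : V}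
    (hxA : ∀ v, v ∈ A → ¬ Linked (G.deleteEdges {s(x, y)}) Xᶜ v y)
    (hsep : ∀ a ∈ A, ∀ b ∈ B, ¬ Linked (G.deleteEdges {s(x, y)}) Xᶜ a b)
    (hZ : ∃ a ∈ A, ∃ b ∈ B, Linked G Zᶜ a b) :
    ∃ a ∈ A, ∃ b ∈ insert x X, Linked (G.deleteEdges {s(x, y)}) Zᶜ a b := by
  by_contra! hcon
  obtain ⟨a, ha, b, hb, hab⟩ := hZ
  have haX : a ∉ insert x X := fun haX => hcon a ha a haX (.refl hab.mem_left)
  have key : Linked (G.deleteEdges {s(x, y)}) Zᶜ a b ∧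
      Linked (G.deleteEdges {s(x, y)}) Xᶜ a b := by
    refine hab.induction (P := fun v => Linked (G.deleteEdges {s(x, y)}) Zᶜ a v ∧
      Linked (G.deleteEdges {s(x, y)}) Xᶜ a v) ⟨.refl hab.mem_left,
        .refl fun h => haX (Or.inr h)⟩ ?_
    rintro u v hu hv huv ⟨h1, h2⟩
    have hux : u ≠ x := by
      rintro rfl
      exact hcon a ha u (Or.inl rfl) h1
    have huy : u ≠ y := by
      rintro rfl
      exact hxA a ha h2
    have hadj : (G.deleteEdges {s(x, y)}).Adj u v := by
      rw [SimpleGraph.deleteEdges_adj]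
      refine ⟨huv, ?_⟩
      simp [hux, huy]
    have h3 := h1.tail hadj hv
    exact ⟨h3, h2.tail hadj fun hvX => hcon a ha v (Or.inr hvX) h3⟩
  exact hsep a ha b hb key.2

/-- A family of `k` pairwise disjoint threads from `A` to `B`. -/
def HasThreads (G : SimpleGraph V) (A B : Set V) (k : ℕ) : Prop :=
  ∃ (P : Fin k → Set V) (a b : Fin k → V), (∀ i, IsThread G A B (P i) (a i) (b i)) ∧
    ∀ i j, i ≠ j → Disjoint (P i) (P j)

lemma HasThreads.mono_graph {k : ℕ} (hGH : G ≤ H) (h : HasThreads G A B k) :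
    HasThreads H A B k := by
  obtain ⟨P, a, b, hP, hd⟩ := h
  exact ⟨P, a, b, fun i => (hP i).mono_graph hGH, hd⟩

lemma surj_of_injective_of_ncard_eq [Finite V] {k : ℕ} {X : Set V} (hX : X.ncard = k)
    {f : Fin k → V} (hf : f.Injective) (hmem : ∀ i, f i ∈ X) : ∀ v ∈ X, ∃ i, f i = v := by
  have h : Set.range f = X := by
    refine Set.eq_of_subset_of_ncard_le (Set.range_subset_iff.2 hmem) ?_ X.toFinite
    rw [hX, Set.ncard_range_of_injective hf]
    simp
  intro v hv
  rwa [← h] at hv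

/-- Glue threads from `A` to `insert x X` with threads from `insert y X` to `B`. -/
lemma HasThreads.glue [Finite V] {k : ℕ} {X : Set V} {x y : V} (hxy : G.Adj x y)
    (hsep : ∀ a ∈ A, ∀ b ∈ B, ¬ Linked (G.deleteEdges {s(x, y)}) Xᶜ a b)
    (hx : ∃ a ∈ A, Linked (G.deleteEdges {s(x, y)}) Xᶜ a x)
    (hy : ∃ b ∈ B, Linked (G.deleteEdges {s(x, y)}) Xᶜ b y)
    (hcx : (insert x X).ncard = k) (hcy : (insert y X).ncard = k)
    (hP : HasThreads (G.deleteEdges {s(x, y)}) A (insert x X) k)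
    (hQ : HasThreads (G.deleteEdges {s(x, y)}) (insert y X) B k) : HasThreads G A B k := by
  set G' := G.deleteEdges {s(x, y)} with hG'
  have hle : G' ≤ G := SimpleGraph.deleteEdges_le _
  obtain ⟨P, a, b, hP, hPd⟩ := hP
  obtain ⟨Q, c, d, hQ, hQd⟩ := hQ
  obtain ⟨a₀, ha₀, hax⟩ := hx
  obtain ⟨b₀, hb₀, hby⟩ := hy
  have hxX : x ∉ X := hax.mem_right
  have hyX : y ∉ X := hby.mem_right
  have hb : b.Injective := by
    intro i j hij
    by_contra hne
    exact Set.disjoint_left.1 (hPd i j hne) (hP i).end_mem (hij ▸ (hP j).end_mem)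
  have hc : c.Injective := by
    intro i j hij
    by_contra hne
    exact Set.disjoint_left.1 (hQd i j hne) (hQ i).start_mem (hij ▸ (hQ j).start_mem)
  have hcs := surj_of_injective_of_ncard_eq hcy hc fun i => (hQ i).start_mem'
  have hσ : ∀ i, ∃ j, (b i ∈ X ∧ c j = b i) ∨ (b i = x ∧ c j = y) := by
    intro i
    rcases (hP i).end_mem' with h | h
    · obtain ⟨j, hj⟩ := hcs y (Or.inl rfl)
      exact ⟨j, Or.inr ⟨h, hj⟩⟩
    · obtain ⟨j, hj⟩ := hcs (b i) (Or.inr h)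
      exact ⟨j, Or.inl ⟨h, hj⟩⟩
  choose σ hσ using hσ
  have hσb : ∀ i j, c (σ i) = c (σ j) → i = j := by
    intro i j hij
    apply hb
    rcases hσ i with ⟨h1, h2⟩ | ⟨h1, h2⟩ <;> rcases hσ j with ⟨h3, h4⟩ | ⟨h3, h4⟩
    · rw [← h2, ← h4, hij]
    · exact absurd (by rwa [← h4, ← hij, h2]) hyX
    · exact absurd (by rwa [← h2, hij, h4]) hyX
    · rw [h1, h3]
  have hPA : ∀ i, ∀ z ∈ P i, z = b i ∨ ∃ a ∈ A, Linked G' Xᶜ a z := by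
    intro i z hz
    refine or_iff_not_imp_left.2 fun hzb => ⟨a i, (hP i).start_mem', ?_⟩
    refine ((hP i).linked_start z hz hzb).mono fun w hw hwX => ?_
    exact hw.2 ((hP i).eq_end w hw.1 (Or.inr hwX))
  have hQB : ∀ j, ∀ z ∈ Q j, z = c j ∨ ∃ b ∈ B, Linked G' Xᶜ b z := by
    intro j z hz
    refine or_iff_not_imp_left.2 fun hzb => ⟨d j, (hQ j).end_mem', ?_⟩
    refine ((hQ j).linked_end z hz hzb).symm.mono fun w hw hwX => ?_
    exact hw.2 ((hQ j).eq_start w hw.1 (Or.inr hwX))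
  have hPQ : ∀ i j, i ≠ j → Disjoint (P i) (Q (σ j)) := by
    intro i j hij
    rw [Set.disjoint_left]
    intro z hzP hzQ
    rcases hPA i z hzP with h1 | ⟨a', ha', h1⟩ <;> rcases hQB _ z hzQ with h2 | ⟨b', hb', h2⟩
    · rcases hσ j with ⟨h3, h4⟩ | ⟨h3, h4⟩
      · exact hij (hb (by rw [← h1, h2, h4]))
      · have hbi := (hP i).end_mem'
        rw [← h1, h2, h4] at hbi
        rcases hbi with h | h
        · exact hxy.ne h.symm
        · exact hyX h
    · have hbi := (hP i).end_mem'
      rw [← h1] at hbi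
      rcases hbi with h | h
      · subst h
        exact hsep a₀ ha₀ b' hb' (hax.trans h2.symm)
      · exact h2.mem_right h
    · have hcj := (hQ (σ j)).start_mem'
      rw [← h2] at hcj
      rcases hcj with h | h
      · subst h
        exact hsep a' ha' b₀ hb₀ (h1.trans hby.symm)
      · exact h1.mem_right h
    · exact hsep a' ha' b' hb' (h1.trans h2.symm)
  have hlink : ∀ i, Linked G (P i ∪ Q (σ i)) (a i) (d (σ i)) := by
    intro i
    have h1 : Linked G (P i ∪ Q (σ i)) (a i) (b i) :=
      (((hP i).linked _ (hP i).end_mem).mono_graph hle).mono Set.subset_union_left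
    have h2 : Linked G (P i ∪ Q (σ i)) (c (σ i)) (d (σ i)) :=
      (((hQ (σ i)).linked _ (hQ (σ i)).end_mem).mono_graph hle).mono Set.subset_union_right
    rcases hσ i with ⟨h3, h4⟩ | ⟨h3, h4⟩
    · rw [h4] at h2
      exact h1.trans h2
    · exact (h1.tail (by rw [h3, h4]; exact hxy) h2.mem_left).trans h2
  choose R hRsub a' b' hR using fun i =>
    (hlink i).exists_isThread (hP i).start_mem' (hQ (σ i)).end_mem'
  refine ⟨R, a', b', hR, fun i j hij => ?_⟩
  refine Set.disjoint_of_subset (hRsub i) (hRsub j) ?_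
  rw [Set.disjoint_union_left, Set.disjoint_union_right, Set.disjoint_union_right]
  exact ⟨⟨hPd i j hij, hPQ i j hij⟩, (hPQ j i hij.symm).symm,
    hQd _ _ fun h => hij (hσb i j (by rw [h]))⟩

lemma HasThreads.symm {k : ℕ} (h : HasThreads G A B k) : HasThreads G B A k := by
  obtain ⟨P, a, b, hP, hd⟩ := h
  exact ⟨P, b, a, fun i => (hP i).symm, hd⟩

/-- **Menger's theorem**, vertex version: if no set of fewer than `k` vertices separates `A`
from `B`, then there are `k` disjoint paths from `A` to `B`. -/
theorem hasThreads_of_forall_linked [Finite V] {k : ℕ}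
    (h : ∀ Z : Set V, Z.ncard < k → ∃ a ∈ A, ∃ b ∈ B, Linked G Zᶜ a b) :
    HasThreads G A B k := by
  induction hn : G.edgeSet.ncard using Nat.strong_induction_on generalizing G A B with
  | _ n ih =>
  by_cases hE : ∃ x y, G.Adj x y
  swap
  · push Not at hE
    have hAB : k ≤ (A ∩ B).ncard := by
      by_contra! hlt
      obtain ⟨a, ha, b, hb, hab⟩ := h _ hlt
      have : b = a := hab.induction (P := (· = a)) rfl fun u v _ _ huv =>
        absurd huv (hE u v)
      subst this
      exact hab.mem_left ⟨ha, hb⟩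
    obtain ⟨X, hX, hXk⟩ := Set.exists_subset_card_eq hAB
    have : Nat.card X = k := by rw [Nat.card_coe_set_eq, hXk]
    let e : X ≃ Fin k := Finite.equivFinOfCardEq this
    let f : Fin k → V := fun i => (e.symm i : V)
    have hf : f.Injective := Subtype.val_injective.comp e.symm.injective
    refine ⟨fun i => {f i}, f, f, fun i => ?_, fun i j hij => by simpa using hf.ne hij⟩
    have hi := hX (e.symm i).2
    refine ⟨rfl, rfl, hi.1, hi.2, fun v hv _ => hv, fun v hv _ => hv, ?_, ?_, ?_⟩
    · rintro v rfl
      exact .refl rfl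
    · exact fun v hv hne => absurd hv hne
    · exact fun v hv hne => absurd hv hne
  obtain ⟨x, y, hxy⟩ := hE
  have hlt : (G.deleteEdges {s(x, y)}).edgeSet.ncard < n := by
    rw [← hn, SimpleGraph.edgeSet_deleteEdges]
    refine Set.ncard_lt_ncard ?_ (Set.toFinite _)
    exact Set.sdiff_singleton_ssubset.2 hxy
  have hle : G.deleteEdges {s(x, y)} ≤ G := SimpleGraph.deleteEdges_le _
  by_cases hG' : ∀ Z : Set V, Z.ncard < k →
      ∃ a ∈ A, ∃ b ∈ B, Linked (G.deleteEdges {s(x, y)}) Zᶜ a b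
  · exact (ih _ hlt hG' rfl).mono_graph hle
  push Not at hG'
  obtain ⟨X, hXk, hsep⟩ := hG'
  -- A walk avoiding `X` has to use the deleted edge, in one of the two directions.
  have hcross : ∃ x' y', s(x', y') = s(x, y) ∧ G.Adj x' y' ∧
      (∃ a ∈ A, Linked (G.deleteEdges {s(x, y)}) Xᶜ a x') ∧
      (∃ b ∈ B, Linked (G.deleteEdges {s(x, y)}) Xᶜ b y') := by
    obtain ⟨a, ha, b, hb, hab⟩ := h X hXk
    have hedge : ∀ u v, G.Adj u v → ∀ C : Set V, v ∈ Xᶜ →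
        (∃ a ∈ C, Linked (G.deleteEdges {s(x, y)}) Xᶜ a u) →
        (¬ ∃ a ∈ C, Linked (G.deleteEdges {s(x, y)}) Xᶜ a v) → s(u, v) = s(x, y) := by
      rintro u v huv C hv ⟨a, ha, hau⟩ hnot
      by_contra hne
      refine hnot ⟨a, ha, hau.tail ?_ hv⟩
      rw [SimpleGraph.deleteEdges_adj]
      exact ⟨huv, hne⟩
    obtain ⟨u, v, -, hv, huv, hu, hv'⟩ := hab.exists_exit
      (P := fun v => ∃ a ∈ A, Linked (G.deleteEdges {s(x, y)}) Xᶜ a v)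
      ⟨a, ha, .refl hab.mem_left⟩ (by
        rintro ⟨a', ha', h'⟩
        exact hsep a' ha' b hb h')
    obtain ⟨u', v', -, hv2, huv2, hu2, hv2'⟩ := hab.symm.exists_exit
      (P := fun v => ∃ b ∈ B, Linked (G.deleteEdges {s(x, y)}) Xᶜ b v)
      ⟨b, hb, .refl hab.mem_right⟩ (by
        rintro ⟨b', hb', h'⟩
        exact hsep a ha b' hb' h'.symm)
    have e1 := hedge u v huv A hv hu hv'
    have e2 := hedge u' v' huv2 B hv2 hu2 hv2'
    refine ⟨u, v, e1, huv, hu, ?_⟩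
    rw [← e1, Sym2.eq_iff] at e2
    rcases e2 with ⟨rfl, rfl⟩ | ⟨rfl, rfl⟩
    · obtain ⟨a', ha', h1⟩ := hu
      obtain ⟨b', hb', h2⟩ := hu2
      exact absurd (h1.trans h2.symm) (hsep a' ha' b' hb')
    · exact hu2
  obtain ⟨x', y', hxy', hadj, hA, hB⟩ := hcross
  rw [← hxy'] at hsep hA hB hle hlt
  have hyx' : s(y', x') = s(x', y') := Sym2.eq_swap
  have hA' : ∀ Z : Set V, Z.ncard < k →
      ∃ a ∈ A, ∃ b ∈ insert x' X, Linked (G.deleteEdges {s(x', y')}) Zᶜ a b := by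
    intro Z hZ
    refine exists_linked_insert_of_deleteEdges (fun v hv hl => ?_) hsep (h Z hZ)
    obtain ⟨b, hb, hb'⟩ := hB
    exact hsep v hv b hb (hl.trans hb'.symm)
  have hB' : ∀ Z : Set V, Z.ncard < k →
      ∃ b ∈ B, ∃ c ∈ insert y' X, Linked (G.deleteEdges {s(x', y')}) Zᶜ b c := by
    intro Z hZ
    rw [← hyx']
    refine exists_linked_insert_of_deleteEdges (B := A) (fun v hv hl => ?_) ?_ ?_
    · rw [hyx'] at hl
      obtain ⟨a, ha, ha'⟩ := hA
      exact hsep a ha v hv (ha'.trans hl.symm)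
    · intro b hb a ha hl
      rw [hyx'] at hl
      exact hsep a ha b hb hl.symm
    · obtain ⟨a, ha, b, hb, hl⟩ := h Z hZ
      exact ⟨b, hb, a, ha, hl.symm⟩
  have hcard : ∀ (z : V) (C : Set V), (∀ Z : Set V, Z.ncard < k →
      ∃ a ∈ C, ∃ b ∈ insert z X, Linked (G.deleteEdges {s(x', y')}) Zᶜ a b) →
      (insert z X).ncard = k := by
    intro z C hC
    refine le_antisymm ((Set.ncard_insert_le z X).trans hXk) ?_
    by_contra! hlt'
    obtain ⟨a, -, b, hb, hl⟩ := hC _ hlt'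
    exact hl.mem_right hb
  exact .glue hadj hsep hA hB (hcard _ _ hA') (hcard _ _ hB') (ih _ hlt hA' rfl)
    (ih _ hlt hB' rfl).symm

end Menger

section Partition

variable {V : Type*} [Finite V] {G : SimpleGraph V} {U D : Set V} {s d t : V}

/-- A vertex of `D` other than the root `s` can be moved to `U \ D` keeping `D` connected,
provided `U` has no cut vertex in `D`. -/
lemma exists_peel (hD : LinkedSet G D) (hs : s ∈ D) (hd : d ∈ D) (hds : d ≠ s)
    (ht : t ∈ U \ D) (hDU : D ⊆ U) (hU : ∀ d ∈ D, LinkedSet G (U \ {d})) :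
    ∃ v ∈ D, v ≠ s ∧ (∃ t ∈ U \ D, G.Adj v t) ∧ LinkedSet G (D \ {v}) := by
  have htne : ∀ v ∈ D, t ∈ U \ {v} := fun v hv => ⟨ht.1, fun h => ht.2 (h ▸ hv)⟩
  let cand : Set V := {v | v ∈ D ∧ v ≠ s ∧ ∃ t ∈ U \ D, G.Adj v t}
  have hne : cand.Nonempty := by
    obtain ⟨a, b, ha, hb, hab, haD, hbD⟩ :=
      (hU s hs d ⟨hDU hd, hds⟩ t (htne s hs)).exists_exit (P := (· ∈ D)) hd ht.2
    exact ⟨a, haD, ha.2, b, ⟨hb.1, hbD⟩, hab⟩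
  obtain ⟨v, ⟨hvD, hvs, hvt⟩, hmax⟩ :=
    Set.exists_max_image cand (fun v => {w | Linked G (D \ {v}) s w}.ncard) (Set.toFinite _) hne
  refine ⟨v, hvD, hvs, hvt, linkedSet_of_root s fun w hw => ?_⟩
  by_contra hsw
  obtain ⟨p, q, hp, hq, hpq, hwp, hwq⟩ :=
    (hU v hvD w ⟨hDU hw.1, hw.2⟩ t (htne v hvD)).exists_exit
      (P := fun z => Linked G (D \ {v}) w z) (.refl hw) fun h => ht.2 h.mem_right.1
  have hqD : q ∉ D := fun hqD => hwq (hwp.tail hpq ⟨hqD, hq.2⟩)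
  have hsp : ¬ Linked G (D \ {v}) s p := fun h => hsw (h.trans hwp.symm)
  have hps : p ≠ s := by
    rintro rfl
    exact hsw hwp.symm
  have hsub : ∀ z, Linked G (D \ {v}) s z → Linked G (D \ {p}) s z := by
    intro z hz
    have := hz.induction (P := fun z => Linked G (D \ {v}) s z ∧ Linked G (D \ {p}) s z)
      ⟨.refl hz.mem_left, .refl ⟨hs, hps.symm⟩⟩ (by
        rintro a b ha hb hab ⟨h1, h2⟩
        have h3 := h1.tail hab hb
        refine ⟨h3, h2.tail hab ⟨hb.1, ?_⟩⟩
        rintro rfl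
        exact hsp h3)
    exact this.2
  have hsv : Linked G (D \ {p}) s v := by
    obtain ⟨a, b, ha, hb, hab, hPa, hPb⟩ := (hD s hs v hvD).exists_exit
      (P := fun z => Linked G (D \ {v}) s z) (.refl ⟨hs, hvs.symm⟩) fun h => h.mem_right.2 rfl
    have hbv : b = v := by
      by_contra hbv
      exact hPb (hPa.tail hab ⟨hb, hbv⟩)
    subst hbv
    refine (hsub a hPa).tail hab ⟨hb, ?_⟩
    rintro rfl
    exact hwp.mem_right.2 rfl
  have hcard : {z | Linked G (D \ {v}) s z}.ncard < {z | Linked G (D \ {p}) s z}.ncard := by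
    refine Set.ncard_lt_ncard ⟨hsub, fun h => ?_⟩ (Set.toFinite _)
    exact (h hsv).mem_right.2 rfl
  exact absurd (hmax p ⟨hwp.mem_right.1, hps, q, ⟨hq.1, hqD⟩, hpq⟩) (not_le.2 hcard)

/-- Disjoint connected nonempty subsets of a connected set extend to a partition into
connected sets. -/
lemma exists_linkedSet_partition {ι : Type*} [Nonempty ι] (hU : LinkedSet G U)
    (P : ι → Set V) (hP : ∀ i, LinkedSet G (P i)) (hne : ∀ i, (P i).Nonempty)
    (hsub : ∀ i, P i ⊆ U) (hdisj : ∀ i j, i ≠ j → Disjoint (P i) (P j)) :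
    ∃ Q : ι → Set V, (∀ i, P i ⊆ Q i) ∧ (∀ i, LinkedSet G (Q i)) ∧
      (∀ i j, i ≠ j → Disjoint (Q i) (Q j)) ∧ ⋃ i, Q i = U := by
  classical
  induction hn : (U \ ⋃ i, P i).ncard using Nat.strong_induction_on generalizing P with
  | _ n ih =>
  by_cases hcover : U ⊆ ⋃ i, P i
  · exact ⟨P, fun i => subset_rfl, hP, hdisj, (Set.iUnion_subset hsub).antisymm hcover⟩
  obtain ⟨z, hzU, hz⟩ := Set.not_subset.1 hcover
  obtain ⟨i₀⟩ := ‹Nonempty ι›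
  obtain ⟨y, hy⟩ := hne i₀
  obtain ⟨a, b, ha, hb, hab, hPa, hPb⟩ := (hU y (hsub _ hy) z hzU).exists_exit
    (P := (· ∈ ⋃ i, P i)) (Set.mem_iUnion.2 ⟨_, hy⟩) hz
  obtain ⟨i, hi⟩ := Set.mem_iUnion.1 hPa
  have hbP : ∀ j, b ∉ P j := fun j hj => hPb (Set.mem_iUnion.2 ⟨j, hj⟩)
  have hle : ∀ j, P j ⊆ Function.update P i (insert b (P i)) j := by
    intro j
    by_cases hj : j = i
    · subst hj
      simp
    · simp [hj]
  suffices h : ∃ Q : ι → Set V, (∀ j, Function.update P i (insert b (P i)) j ⊆ Q j) ∧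
      (∀ i, LinkedSet G (Q i)) ∧ (∀ i j, i ≠ j → Disjoint (Q i) (Q j)) ∧ ⋃ i, Q i = U by
    obtain ⟨Q, h1, h2⟩ := h
    exact ⟨Q, fun j => (hle j).trans (h1 j), h2⟩
  refine ih _ ?_ (Function.update P i (insert b (P i))) ?_ ?_ ?_ ?_ rfl
  · rw [← hn]
    refine Set.ncard_lt_ncard ⟨?_, fun h => ?_⟩ (Set.toFinite _)
    · exact Set.sdiff_subset_sdiff_right (Set.iUnion_mono hle)
    · exact (h ⟨hb, hPb⟩).2 (Set.mem_iUnion.2 ⟨i, by simp⟩)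
  · intro j
    by_cases hj : j = i
    · subst hj
      simpa using (hP j).insert hi hab
    · simpa [hj] using hP j
  · exact fun j => (hne j).mono (hle j)
  · intro j
    by_cases hj : j = i
    · subst hj
      simpa using Set.insert_subset hb (hsub j)
    · simpa [hj] using hsub j
  · intro j k hjk
    by_cases hj : j = i
    · subst hj
      simpa [hjk.symm] using ⟨hbP k, hdisj _ _ hjk⟩
    · by_cases hk : k = i
      · subst hk
        simpa [hj] using ⟨hbP j, hdisj _ _ hjk⟩
      · simpa [hj, hk] using hdisj _ _ hjk

end Partition

section CrossSum

variable {V : Type*} [Fintype V] {w : V → V → ℝ} {A A' B B' : Set V}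

/-- The total weight of the pairs in `A × B`. -/
noncomputable def crossSum (w : V → V → ℝ) (A B : Set V) : ℝ :=
  ∑ u, ∑ v, A.indicator 1 u * w u v * B.indicator 1 v

lemma crossSum_comm (hw : ∀ u v, w u v = w v u) (A B : Set V) :
    crossSum w A B = crossSum w B A := by
  unfold crossSum
  rw [Finset.sum_comm]
  refine Finset.sum_congr rfl fun u _ => Finset.sum_congr rfl fun v _ => ?_
  rw [hw v u]
  ring

lemma crossSum_union_right (h : Disjoint B B') :
    crossSum w A (B ∪ B') = crossSum w A B + crossSum w A B' := by
  simp only [crossSum, Set.indicator_union_of_disjoint h, Finset.sum_add_distrib, mul_add]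

lemma crossSum_union_left (h : Disjoint A A') :
    crossSum w (A ∪ A') B = crossSum w A B + crossSum w A' B := by
  simp only [crossSum, Set.indicator_union_of_disjoint h, Finset.sum_add_distrib, add_mul]

lemma crossSum_singleton (u v : V) : crossSum w {u} {v} = w u v := by
  classical
  simp [crossSum, Set.indicator_apply]

lemma crossSum_eq_zero (h : ∀ u ∈ A, ∀ v ∈ B, w u v = 0) : crossSum w A B = 0 := by
  refine Finset.sum_eq_zero fun u _ => Finset.sum_eq_zero fun v _ => ?_
  by_cases hu : u ∈ A
  · by_cases hv : v ∈ B
    · simp [h u hu v hv]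
    · simp [hv]
  · simp [hu]

lemma crossSum_add (f g : V → V → ℝ) (A B : Set V) :
    crossSum (fun x y => f x y + g x y) A B = crossSum f A B + crossSum g A B := by
  simp only [crossSum, mul_add, add_mul, Finset.sum_add_distrib]

lemma crossSum_sum {ι : Type*} (s : Finset ι) (a : ι → ℝ) (f : ι → V → V → ℝ) (A B : Set V) :
    crossSum (fun x y => ∑ i ∈ s, a i * f i x y) A B = ∑ i ∈ s, a i * crossSum (f i) A B := by
  simp only [crossSum, Finset.mul_sum, Finset.sum_mul]
  rw [Finset.sum_comm_cycle]
  refine Finset.sum_congr rfl fun i _ => Finset.sum_congr rfl fun u _ =>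
    Finset.sum_congr rfl fun v _ => ?_
  ring

end CrossSum

section Tripod

variable {V : Type*} {G : SimpleGraph V} {C S A B D : Set V} {x : V}

lemma ncard_pair_le_two (u v : V) : ({u, v} : Set V).ncard ≤ 2 := by
  have := Set.ncard_insert_le u {v}
  rwa [Set.ncard_singleton] at this

/-- Both sides of the partition `S, Sᶜ` are connected and meet `C`. -/
structure Splits (G : SimpleGraph V) (C S : Set V) : Prop where
  linked : LinkedSet G S
  linked_compl : LinkedSet G Sᶜ
  meets : (S ∩ C).Nonempty
  meets_compl : (Sᶜ ∩ C).Nonempty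

/-- `A`, `B`, `D` partition the complement of `x` into connected sets that meet `C` and contain
a neighbour of `x`. -/
structure Tripod (G : SimpleGraph V) (C : Set V) (x : V) (A B D : Set V) : Prop where
  linked_fst : LinkedSet G A
  linked_snd : LinkedSet G B
  linked_trd : LinkedSet G D
  disj_fst_snd : Disjoint A B
  disj_fst_trd : Disjoint A D
  disj_snd_trd : Disjoint B D
  cover : A ∪ B ∪ D = {x}ᶜ
  meets_fst : (A ∩ C).Nonempty
  meets_snd : (B ∩ C).Nonempty
  meets_trd : (D ∩ C).Nonempty
  adj_fst : ∃ a ∈ A, G.Adj x a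
  adj_snd : ∃ b ∈ B, G.Adj x b
  adj_trd : ∃ d ∈ D, G.Adj x d

namespace Tripod

lemma rotate (h : Tripod G C x A B D) : Tripod G C x B D A where
  linked_fst := h.linked_snd
  linked_snd := h.linked_trd
  linked_trd := h.linked_fst
  disj_fst_snd := h.disj_snd_trd
  disj_fst_trd := h.disj_fst_snd.symm
  disj_snd_trd := h.disj_fst_trd.symm
  cover := by rw [← h.cover, Set.union_comm, Set.union_assoc]
  meets_fst := h.meets_snd
  meets_snd := h.meets_trd
  meets_trd := h.meets_fst
  adj_fst := h.adj_snd
  adj_snd := h.adj_trd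
  adj_trd := h.adj_fst

lemma swap (h : Tripod G C x A B D) : Tripod G C x B A D where
  linked_fst := h.linked_snd
  linked_snd := h.linked_fst
  linked_trd := h.linked_trd
  disj_fst_snd := h.disj_fst_snd.symm
  disj_fst_trd := h.disj_snd_trd
  disj_snd_trd := h.disj_fst_trd
  cover := by rw [← h.cover, Set.union_comm A]
  meets_fst := h.meets_snd
  meets_snd := h.meets_fst
  meets_trd := h.meets_trd
  adj_fst := h.adj_snd
  adj_snd := h.adj_fst
  adj_trd := h.adj_trd

lemma notMem_fst (h : Tripod G C x A B D) : x ∉ A := fun hx =>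
  (h.cover.subset (Or.inl (Or.inl hx)) : x ∈ ({x} : Set V)ᶜ) rfl

lemma compl_fst (h : Tripod G C x A B D) : Aᶜ = {x} ∪ (B ∪ D) := by
  ext v
  have h1 : v ∈ A ∪ B ∪ D ↔ v ∈ ({x} : Set V)ᶜ := by rw [h.cover]
  have h2 : v ∈ A → v ∉ B := fun hv => Set.disjoint_left.1 h.disj_fst_snd hv
  have h3 : v ∈ A → v ∉ D := fun hv => Set.disjoint_left.1 h.disj_fst_trd hv
  simp only [Set.mem_union, Set.mem_compl_iff, Set.mem_singleton_iff] at h1 ⊢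
  tauto

lemma compl_insert_fst (h : Tripod G C x A B D) : ({x} ∪ A)ᶜ = B ∪ D := by
  rw [Set.compl_union, h.compl_fst, Set.inter_union_distrib_left, Set.compl_inter_self,
    Set.empty_union, Set.inter_eq_right, Set.subset_compl_singleton_iff]
  exact fun hx => hx.elim h.rotate.notMem_fst h.rotate.rotate.notMem_fst

lemma splits_fst (h : Tripod G C x A B D) : Splits G C A := by
  refine ⟨h.linked_fst, ?_, h.meets_fst, ?_⟩
  · rw [h.compl_fst]
    obtain ⟨b, hb, hxb⟩ := h.adj_snd
    obtain ⟨d, hd, hxd⟩ := h.adj_trd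
    rw [← Set.union_assoc]
    exact ((linkedSet_singleton x).union h.linked_snd rfl hb hxb).union h.linked_trd
      (Or.inl rfl) hd hxd
  · rw [h.compl_fst]
    exact h.meets_snd.mono (Set.inter_subset_inter_left _ fun _ hv => Or.inr (Or.inl hv))

/-- The third part of a tripod can be shrunk by moving one vertex to one of the other parts. -/
lemma move (h : Tripod G C x A B D) {v a : V} (hv : v ∈ D) (hDv : LinkedSet G (D \ {v}))
    (hC : (D \ {v} ∩ C).Nonempty) (ha : a ∈ A) (hva : G.Adj v a)
    (hadj : ∃ d ∈ D \ {v}, G.Adj x d) : Tripod G C x (insert v A) B (D \ {v}) where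
  linked_fst := h.linked_fst.insert ha hva.symm
  linked_snd := h.linked_snd
  linked_trd := hDv
  disj_fst_snd := Set.disjoint_insert_left.2
    ⟨fun hvB => Set.disjoint_left.1 h.disj_snd_trd hvB hv, h.disj_fst_snd⟩
  disj_fst_trd := Set.disjoint_insert_left.2
    ⟨fun hvD => hvD.2 rfl, h.disj_fst_trd.mono_right Set.sdiff_subset⟩
  disj_snd_trd := h.disj_snd_trd.mono_right Set.sdiff_subset
  cover := by
    rw [← h.cover]
    ext z
    by_cases hz : z = v
    · simp [hz, hv]
    · simp [hz]
  meets_fst := h.meets_fst.mono (Set.inter_subset_inter_left _ (Set.subset_insert _ _))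
  meets_snd := h.meets_snd
  meets_trd := hC
  adj_fst := h.adj_fst.imp fun _ h => ⟨Or.inr h.1, h.2⟩
  adj_snd := h.adj_snd
  adj_trd := hadj

variable [Fintype V] {f : V → V → ℝ}

lemma crossSum_fst (h : Tripod G C x A B D) (hf : ∀ u v, f u v = f v u) :
    crossSum f A Aᶜ = crossSum f {x} A + (crossSum f A B + crossSum f A D) := by
  rw [h.compl_fst, crossSum_union_right, crossSum_union_right h.disj_snd_trd,
    crossSum_comm hf A {x}]
  rw [← h.compl_insert_fst, Set.disjoint_compl_right_iff_subset]
  exact Set.subset_union_left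

lemma crossSum_insert_fst (h : Tripod G C x A B D) :
    crossSum f ({x} ∪ A) ({x} ∪ A)ᶜ =
      crossSum f {x} B + crossSum f {x} D + (crossSum f A B + crossSum f A D) := by
  rw [h.compl_insert_fst, crossSum_union_left, crossSum_union_right h.disj_snd_trd,
    crossSum_union_right h.disj_snd_trd]
  exact Set.disjoint_singleton_left.2 h.notMem_fst

end Tripod

end Tripod

section Rigid

variable {V : Type*} [Fintype V] {G : SimpleGraph V} {C S A B D : Set V} {x : V}
  {κ w : V → V → ℝ}

/-- A symmetric weight supported on edges inside `C` all of whose splitting cuts have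
value `2`. -/
structure IsRing (G : SimpleGraph V) (C : Set V) (κ : V → V → ℝ) : Prop where
  symm : ∀ u v, κ u v = κ v u
  eq_zero_of_notMem : ∀ u ∉ C, ∀ v, κ u v = 0
  eq_zero_of_not_adj : ∀ u v, ¬ G.Adj u v → κ u v = 0
  crossSum_eq : ∀ S, Splits G C S → crossSum κ S Sᶜ = 2

/-- A symmetric weight supported on edges all of whose splitting cuts have value `0`. -/
structure IsNull (G : SimpleGraph V) (C : Set V) (w : V → V → ℝ) : Prop where
  symm : ∀ u v, w u v = w v u
  eq_zero_of_not_adj : ∀ u v, ¬ G.Adj u v → w u v = 0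
  crossSum_eq : ∀ S, Splits G C S → crossSum w S Sᶜ = 0

lemma IsRing.exists_adj (hκ : IsRing G C κ) (hx : x ∉ C) (h : Tripod G C x A B D) :
    ∃ a ∈ A, ∃ b ∈ B, G.Adj a b := by
  have h0 : ∀ T, crossSum κ {x} T = 0 := fun T => crossSum_eq_zero fun u hu v _ =>
    hκ.eq_zero_of_notMem u (by rwa [Set.mem_singleton_iff.1 hu]) v
  have h1 := h.crossSum_fst hκ.symm
  have h2 := h.rotate.crossSum_fst hκ.symm
  have h3 := h.rotate.rotate.crossSum_fst hκ.symm
  rw [hκ.crossSum_eq _ h.splits_fst, h0] at h1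
  rw [hκ.crossSum_eq _ h.rotate.splits_fst, h0] at h2
  rw [hκ.crossSum_eq _ h.rotate.rotate.splits_fst, h0] at h3
  have hAB : crossSum κ A B = 1 := by
    linarith [crossSum_comm hκ.symm A B, crossSum_comm hκ.symm A D, crossSum_comm hκ.symm B D]
  by_contra! hno
  rw [crossSum_eq_zero fun a ha b hb => hκ.eq_zero_of_not_adj a b (hno a ha b hb)] at hAB
  exact zero_ne_one hAB

lemma IsRing.splits_insert (hκ : IsRing G C κ) (hx : x ∉ C) (h : Tripod G C x A B D) :
    Splits G C ({x} ∪ A) := by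
  obtain ⟨a, ha, hxa⟩ := h.adj_fst
  obtain ⟨b, hb, d, hd, hbd⟩ := hκ.exists_adj hx h.rotate
  refine ⟨(linkedSet_singleton x).union h.linked_fst rfl ha hxa, ?_,
    h.meets_fst.mono (Set.inter_subset_inter_left _ Set.subset_union_right), ?_⟩
  · rw [h.compl_insert_fst]
    exact h.linked_snd.union h.linked_trd hb hd hbd
  · rw [h.compl_insert_fst]
    exact h.meets_snd.mono (Set.inter_subset_inter_left _ Set.subset_union_left)

lemma IsNull.crossSum_singleton_fst (hw : IsNull G C w) (hκ : IsRing G C κ) (hx : x ∉ C)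
    (h : Tripod G C x A B D) :
    crossSum w {x} A = crossSum w {x} B + crossSum w {x} D := by
  have h1 := h.crossSum_fst hw.symm
  have h2 := h.crossSum_insert_fst (f := w)
  rw [hw.crossSum_eq _ h.splits_fst] at h1
  rw [hw.crossSum_eq _ (hκ.splits_insert hx h)] at h2
  linarith

lemma IsNull.crossSum_singleton_trd (hw : IsNull G C w) (hκ : IsRing G C κ) (hx : x ∉ C)
    (h : Tripod G C x A B D) : crossSum w {x} D = 0 := by
  have h1 := hw.crossSum_singleton_fst hκ hx h
  have h2 := hw.crossSum_singleton_fst hκ hx h.rotate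
  linarith

lemma IsNull.eq_zero_of_mem_trd (hG : ∀ W : Set V, W.ncard ≤ 2 → LinkedSet G Wᶜ)
    (hw : IsNull G C w) (hκ : IsRing G C κ) (hx : x ∉ C)
    (h : Tripod G C x A B D) : ∀ y ∈ D, w x y = 0 := by
  classical
  induction hn : D.ncard using Nat.strong_induction_on generalizing A B D with
  | _ n ih =>
  obtain ⟨s, hsD, hsC⟩ := h.meets_trd
  have hsum := hw.crossSum_singleton_trd hκ hx h
  have hpeel : ∃ v ∈ D, ∀ y ∈ D \ {v}, w x y = 0 := by
    by_cases hD : ∃ d ∈ D, d ≠ s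
    · obtain ⟨d, hd, hds⟩ := hD
      obtain ⟨t, ht, -⟩ := h.meets_fst
      have hDU : D ⊆ {x}ᶜ := h.cover ▸ Set.subset_union_right
      have htU : t ∈ ({x}ᶜ : Set V) \ D :=
        ⟨h.cover ▸ Or.inl (Or.inl ht), Set.disjoint_left.1 h.disj_fst_trd ht⟩
      obtain ⟨v, hvD, hvs, ⟨b, hb, hvb⟩, hDv⟩ := exists_peel (U := {x}ᶜ) h.linked_trd hsD hd hds
        htU hDU fun d _ => by
          have : ({x}ᶜ : Set V) \ {d} = ({x, d} : Set V)ᶜ := by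
            ext z
            simp
          rw [this]
          exact hG _ (ncard_pair_le_two x d)
      refine ⟨v, hvD, ?_⟩
      by_cases hadj : ∃ d ∈ D \ {v}, G.Adj x d
      · have hC : (D \ {v} ∩ C).Nonempty := ⟨s, ⟨hsD, hvs.symm⟩, hsC⟩
        have hlt : (D \ {v}).ncard < n := hn ▸ Set.ncard_sdiff_singleton_lt_of_mem hvD
        have hbAB : b ∈ A ∨ b ∈ B := by
          rcases h.cover.symm.subset hb.1 with h' | h'
          · exact h'
          · exact absurd h' hb.2
        rcases hbAB with hbA | hbB
        · exact ih _ hlt (h.move hvD hDv hC hbA hvb hadj) rfl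
        · exact ih _ hlt (h.swap.move hvD hDv hC hbB hvb hadj) rfl
      · exact fun y hy => hw.eq_zero_of_not_adj x y fun hxy => hadj ⟨y, hy, hxy⟩
    · push Not at hD
      exact ⟨s, hsD, fun y hy => absurd (hD y hy.1) hy.2⟩
  obtain ⟨v, hvD, hv⟩ := hpeel
  have hsplit : D = (D \ {v}) ∪ {v} := by
    rw [Set.sdiff_union_self, Set.union_singleton, Set.insert_eq_of_mem hvD]
  rw [hsplit, crossSum_union_right Set.disjoint_sdiff_left, crossSum_singleton,
    crossSum_eq_zero fun u hu y hy => by rw [Set.mem_singleton_iff.1 hu]; exact hv y hy,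
    zero_add] at hsum
  intro y hy
  by_cases hyv : y = v
  · rwa [hyv]
  · exact hv y ⟨hy, hyv⟩

lemma exists_tripod (hG : ∀ W : Set V, W.ncard ≤ 2 → LinkedSet G Wᶜ) (hC : 3 ≤ C.ncard)
    (hx : x ∉ C) : ∃ P : Fin 3 → Set V, Tripod G C x (P 0) (P 1) (P 2) := by
  have hU : LinkedSet G {x}ᶜ := hG _ (by simp)
  have hthreads : HasThreads (G.deleteEdges (G.incidenceSet x)) {y | G.Adj x y} C 3 := by
    refine hasThreads_of_forall_linked fun Z hZ => ?_
    obtain ⟨c, hcC, hcZ⟩ := Set.exists_mem_notMem_of_ncard_lt_ncard (hZ.trans_le hC)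
    have hxc : x ≠ c := fun h => hx (h ▸ hcC)
    have hlink : Linked G (Z \ {x})ᶜ x c :=
      hG _ ((Set.ncard_le_ncard Set.sdiff_subset).trans (Nat.le_of_lt_succ hZ)) x (by simp) c
        (by simp [hcZ])
    classical
    obtain ⟨p, hp⟩ := hlink
    have hp' : ∀ z ∈ p.bypass.support, z ∈ (Z \ {x})ᶜ := fun z hz =>
      hp z (p.support_bypass_subset_support hz)
    have hpath := p.bypass_isPath
    generalize p.bypass = q at hp' hpath
    cases q with
    | nil => exact absurd rfl hxc
    | cons hadj q =>
      rename_i y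
      rw [SimpleGraph.Walk.cons_isPath_iff] at hpath
      refine ⟨y, hadj, c, hcC, ?_⟩
      have hmem : ∀ z ∈ q.support, z ≠ x ∧ z ∉ Z := fun z hz => by
        have hzx : z ≠ x := fun h => hpath.2 (h ▸ hz)
        have := hp' z (by simp [hz])
        simpa [hzx] using this
      refine ⟨q.transfer _ fun e he => ?_, fun z hz => ?_⟩
      · rw [SimpleGraph.edgeSet_deleteEdges]
        refine ⟨q.edges_subset_edgeSet he, fun hxe => ?_⟩
        exact (hmem x (q.mem_support_of_mem_edges he hxe.2)).1 rfl
      · rw [SimpleGraph.Walk.support_transfer] at hz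
        exact (hmem z hz).2
  obtain ⟨P, a, b, hP, hdisj⟩ := hthreads
  have hxP : ∀ i, x ∉ P i := fun i hxi => by
    obtain ⟨u, v, -, -, huv, -, hv⟩ := ((hP i).linked x hxi).exists_exit (P := (· ≠ x))
      (hP i).start_mem'.ne' (not_not.2 rfl)
    obtain rfl := not_not.1 hv
    rw [SimpleGraph.deleteEdges_adj] at huv
    exact huv.2 ⟨huv.1, by simp⟩
  obtain ⟨Q, hPQ, hQ, hQdisj, hQU⟩ := exists_linkedSet_partition hU P
    (fun i => linkedSet_of_root (a i) fun v hv =>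
      ((hP i).linked v hv).mono_graph (SimpleGraph.deleteEdges_le _))
    (fun i => ⟨a i, (hP i).start_mem⟩) (fun i z hz hzx => hxP i (hzx ▸ hz)) hdisj
  have hmeets : ∀ i, (Q i ∩ C).Nonempty := fun i =>
    ⟨b i, hPQ i (hP i).end_mem, (hP i).end_mem'⟩
  have hadj : ∀ i, ∃ y ∈ Q i, G.Adj x y := fun i =>
    ⟨a i, hPQ i (hP i).start_mem, (hP i).start_mem'⟩
  refine ⟨Q, hQ 0, hQ 1, hQ 2, hQdisj 0 1 (by decide), hQdisj 0 2 (by decide),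
    hQdisj 1 2 (by decide), ?_, hmeets 0, hmeets 1, hmeets 2, hadj 0, hadj 1, hadj 2⟩
  rw [← hQU]
  ext z
  simp [Fin.exists_fin_succ, or_assoc]

lemma IsNull.eq_zero_of_notMem (hG : ∀ W : Set V, W.ncard ≤ 2 → LinkedSet G Wᶜ)
    (hC : 3 ≤ C.ncard) (hw : IsNull G C w) (hκ : IsRing G C κ) (hx : x ∉ C) (y : V) :
    w x y = 0 := by
  obtain ⟨P, hP⟩ := exists_tripod hG hC hx
  by_cases hxy : G.Adj x y
  · have hy : y ∈ P 0 ∪ P 1 ∪ P 2 := hP.cover.symm.subset hxy.ne'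
    rcases hy with (hy | hy) | hy
    · exact hw.eq_zero_of_mem_trd hG hκ hx hP.rotate y hy
    · exact hw.eq_zero_of_mem_trd hG hκ hx hP.rotate.rotate y hy
    · exact hw.eq_zero_of_mem_trd hG hκ hx hP y hy
  · exact hw.eq_zero_of_not_adj x y hxy

lemma splits_singleton (hG : ∀ W : Set V, W.ncard ≤ 2 → LinkedSet G Wᶜ)
    (hC : 3 ≤ C.ncard) (hx : x ∈ C) : Splits G C {x} := by
  refine ⟨linkedSet_singleton x, hG _ (by simp), ⟨x, rfl, hx⟩, ?_⟩
  obtain ⟨c, hcC, hc⟩ := Set.exists_mem_notMem_of_ncard_lt_ncard (s := {x}) (t := C)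
    (by rw [Set.ncard_singleton]; omega)
  exact ⟨c, hc, hcC⟩

lemma splits_pair (hG : ∀ W : Set V, W.ncard ≤ 2 → LinkedSet G Wᶜ)
    (hC : 3 ≤ C.ncard) (hx : x ∈ C) {y : V} (hxy : G.Adj x y) : Splits G C ({x} ∪ {y}) := by
  have hle : ({x} ∪ {y} : Set V).ncard ≤ 2 := ncard_pair_le_two x y
  refine ⟨(linkedSet_singleton x).union (linkedSet_singleton y) rfl rfl hxy, hG _ hle,
    ⟨x, Or.inl rfl, hx⟩, ?_⟩
  obtain ⟨c, hcC, hc⟩ := Set.exists_mem_notMem_of_ncard_lt_ncard (s := {x} ∪ {y}) (t := C)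
    (by omega)
  exact ⟨c, hc, hcC⟩

/-- In a 3-connected graph, a weight supported on edges whose cuts splitting the ring all vanish
is zero. -/
theorem IsNull.eq_zero (hG : ∀ W : Set V, W.ncard ≤ 2 → LinkedSet G Wᶜ)
    (hC : 3 ≤ C.ncard) (hw : IsNull G C w) (hκ : IsRing G C κ) (x y : V) : w x y = 0 := by
  by_cases hxy : G.Adj x y
  swap
  · exact hw.eq_zero_of_not_adj x y hxy
  by_cases hx : x ∈ C
  swap
  · exact hw.eq_zero_of_notMem hG hC hκ hx y
  by_cases hy : y ∈ C
  swap
  · rw [hw.symm]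
    exact hw.eq_zero_of_notMem hG hC hκ hy x
  have hne : Disjoint ({x} : Set V) {y} := by simpa using hxy.ne
  have h1 := hw.crossSum_eq _ (splits_singleton hG hC hx)
  have h2 := hw.crossSum_eq _ (splits_singleton hG hC hy)
  have h3 := hw.crossSum_eq _ (splits_pair hG hC hx hxy)
  set Z : Set V := ({x} ∪ {y})ᶜ with hZ
  have hxc : ({x} : Set V)ᶜ = {y} ∪ Z := by
    ext z
    have := hxy.ne'
    by_cases hzy : z = y <;> simp_all
  have hyc : ({y} : Set V)ᶜ = {x} ∪ Z := by
    ext z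
    have := hxy.ne
    by_cases hzx : z = x <;> simp_all
  have hxZ : Disjoint {x} Z := by simp [hZ]
  have hyZ : Disjoint {y} Z := by simp [hZ]
  rw [hxc, crossSum_union_right hyZ, crossSum_singleton] at h1
  rw [hyc, crossSum_union_right hxZ, crossSum_singleton, hw.symm] at h2
  rw [crossSum_union_left hne] at h3
  linarith

end Rigid

section Cycle

variable {V : Type*} {G : SimpleGraph V} {S : Set V} {v : V}

/-- A connected set visited by the closed walk `c` both strictly between the positions `p`, `q`
and outside of them, but not at these positions, contains a link between the two arcs of `c`
avoiding the edges of `c`. -/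
lemma exists_linked_deleteEdges (c : G.Walk v v) (hS : LinkedSet G S) {p q i j : ℕ}
    (hpS : c.getVert p ∉ S) (hqS : c.getVert q ∉ S)
    (hpi : p < i) (hiq : i < q) (hj : j < c.length) (hjpq : j < p ∨ q < j)
    (hiS : c.getVert i ∈ S) (hjS : c.getVert j ∈ S) :
    ∃ i' j', p < i' ∧ i' < q ∧ j' < c.length ∧ (j' < p ∨ q < j') ∧
      Linked (G.deleteEdges {e | e ∈ c.edges}) S (c.getVert i') (c.getVert j') := by
  by_contra! hno
  obtain ⟨a, b, -, hb, hab, ⟨i', hpi', hiq', hi'⟩, hbI⟩ := (hS _ hiS _ hjS).exists_exit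
    (P := fun x => ∃ i', p < i' ∧ i' < q ∧
      Linked (G.deleteEdges {e | e ∈ c.edges}) S (c.getVert i') x)
    ⟨i, hpi, hiq, .refl hiS⟩ fun ⟨i', h1, h2, h3⟩ => hno i' j h1 h2 hj hjpq h3
  have hinside : ∀ k, k < c.length → c.getVert k = a → p < k ∧ k < q := by
    rintro k hk rfl
    have hkp : k ≠ p := fun h => hpS (h ▸ hi'.mem_right)
    have hkq : k ≠ q := fun h => hqS (h ▸ hi'.mem_right)
    by_contra hout
    exact hno i' k hpi' hiq' hk (by omega) hi'
  have hnear : ∀ k, p ≤ k → k ≤ q → c.getVert k ≠ b := by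
    rintro k hpk hkq rfl
    have hkp : k ≠ p := fun h => hpS (h ▸ hb)
    have hkq' : k ≠ q := fun h => hqS (h ▸ hb)
    exact hbI ⟨k, by omega, by omega, .refl hb⟩
  have hedge : s(a, b) ∈ c.edges := by
    by_contra he
    exact hbI ⟨i', hpi', hiq', hi'.tail (by simpa [SimpleGraph.deleteEdges_adj] using ⟨hab, he⟩) hb⟩
  obtain ⟨k, hk, hkab⟩ := List.getElem_of_mem hedge
  rw [SimpleGraph.Walk.getElem_edges, Sym2.eq_iff] at hkab
  rw [SimpleGraph.Walk.length_edges] at hk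
  rcases hkab with ⟨ha, hb'⟩ | ⟨hb', ha⟩
  · obtain ⟨h1, h2⟩ := hinside k hk ha
    exact hnear (k + 1) (by omega) (by omega) hb'
  · by_cases hkn : k + 1 = c.length
    · rw [hkn, SimpleGraph.Walk.getVert_length, ← c.getVert_zero] at ha
      have := hinside 0 (by omega) ha
      omega
    · obtain ⟨h1, h2⟩ := hinside (k + 1) (by omega) ha
      exact hnear k (by omega) (by omega) hb'

lemma Linked.exists_isPath {u w : V} (h : Linked G S u w) :
    ∃ p : G.Walk u w, p.IsPath ∧ ∀ x ∈ p.support, x ∈ S := by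
  classical
  obtain ⟨p, hp⟩ := h
  exact ⟨p.bypass, p.bypass_isPath, fun x hx => hp x (p.support_bypass_subset_support hx)⟩

lemma isInterleaved_of_linked (c : G.Walk v v) {i j k l : ℕ} (hij : i < j) (hjk : j < k)
    (hkl : k < l) (hl : l < c.length)
    (h₁ : Linked (G.deleteEdges {e | e ∈ c.edges}) S (c.getVert i) (c.getVert k))
    (h₂ : Linked (G.deleteEdges {e | e ∈ c.edges}) Sᶜ (c.getVert j) (c.getVert l)) :
    IsInterleaved G c := by
  obtain ⟨q₁, hq₁, hS₁⟩ := h₁.exists_isPath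
  obtain ⟨q₂, hq₂, hS₂⟩ := h₂.exists_isPath
  exact ⟨i, j, k, l, hij, hjk, hkl, hl, q₁, q₂, hq₁, hq₂, fun x h1 h2 => hS₂ x h2 (hS₁ x h1)⟩

/-- If two complementary connected sets alternate along `c` then `c` is interleaved. -/
lemma isInterleaved_of_alternating (c : G.Walk v v) (hS : LinkedSet G S) (hS' : LinkedSet G Sᶜ)
    {i j k l : ℕ} (hij : i < j) (hjk : j < k) (hkl : k < l) (hl : l < c.length)
    (hi : c.getVert i ∈ S) (hj : c.getVert j ∉ S) (hk : c.getVert k ∈ S)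
    (hl' : c.getVert l ∉ S) : IsInterleaved G c := by
  have key : ∀ p q r s : ℕ, p < q → q < c.length → s < c.length →
      Linked (G.deleteEdges {e | e ∈ c.edges}) S (c.getVert p) (c.getVert q) →
      p < r → r < q → (s < p ∨ q < s) → c.getVert r ∈ Sᶜ → c.getVert s ∈ Sᶜ →
      IsInterleaved G c := by
    intro p q r s hpq hq hs hlink hpr hrq hspq hrS hsS
    obtain ⟨r', s', h1, h2, h3, h4, hlink'⟩ := exists_linked_deleteEdges c hS'
      (not_not.2 hlink.mem_left) (not_not.2 hlink.mem_right) hpr hrq hs hspq hrS hsS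
    rcases h4 with h4 | h4
    · have hlink'' : Linked (G.deleteEdges {e | e ∈ c.edges}) Sᶜᶜ (c.getVert p) (c.getVert q) := by
        rwa [compl_compl]
      exact isInterleaved_of_linked c h4 h1 h2 hq hlink'.symm hlink''
    · exact isInterleaved_of_linked c h1 h2 h4 h3 hlink hlink'
  obtain ⟨k', i', h1, h2, h3, h4, hlink⟩ := exists_linked_deleteEdges c hS hj hl' hjk hkl
    (by omega) (Or.inl hij) hk hi
  rcases h4 with h4 | h4
  · exact key i' k' j l (by omega) (by omega) hl hlink.symm h4 h1 (Or.inr h2) hj hl'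
  · exact key k' i' l j (by omega) h3 (by omega) hlink h2 h4 (Or.inl h1) hl' hj

/-- A cyclic two-colouring that does not alternate twice has exactly two colour changes. -/
lemma exists_two_changes {n : ℕ} {b : ℕ → Prop} (hn : b n ↔ b 0)
    (hb : ∀ i j k l, i < j → j < k → k < l → l < n → (b i ↔ b k) → (b j ↔ b l) → (b i ↔ b j))
    {m : ℕ} (hm : m < n) (hbm : ¬ (b m ↔ b 0)) :
    ∃ p q, p < q ∧ q < n ∧ ∀ k < n, ¬ (b k ↔ b (k + 1)) ↔ k = p ∨ k = q := by
  classical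
  have hex : ∃ k, ¬ (b (k + 1) ↔ b 0) := by
    cases m with
    | zero => exact absurd Iff.rfl hbm
    | succ m => exact ⟨m, hbm⟩
  obtain ⟨p, hp, hpmin⟩ : ∃ p, ¬ (b (p + 1) ↔ b 0) ∧ ∀ k ≤ p, b k ↔ b 0 := by
    refine ⟨Nat.find hex, Nat.find_spec hex, fun k hk => ?_⟩
    cases k with
    | zero => exact Iff.rfl
    | succ k => exact not_not.1 (Nat.find_min hex hk)
  have hpm : p < m := by
    by_contra h
    exact hbm (hpmin m (by omega))
  have hex' : ∃ k, p < k ∧ (b (k + 1) ↔ b 0) := by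
    refine ⟨n - 1, by omega, ?_⟩
    rwa [Nat.sub_add_cancel (by omega)]
  obtain ⟨q, hpq, hq, hqmin⟩ :
      ∃ q, p < q ∧ (b (q + 1) ↔ b 0) ∧ ∀ k, p < k → k ≤ q → ¬ (b k ↔ b 0) := by
    refine ⟨Nat.find hex', (Nat.find_spec hex').1, (Nat.find_spec hex').2, fun k hpk hk => ?_⟩
    cases k with
    | zero => omega
    | succ k =>
      rcases (show p ≤ k by omega).eq_or_lt with rfl | hlt
      · exact hp
      · exact fun h => Nat.find_min hex' hk ⟨hlt, h⟩
  have hqn : q < n := by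
    by_contra h
    exact hqmin n (by omega) (by omega) hn
  have hafter : ∀ k, q < k → k ≤ n → (b k ↔ b 0) := by
    intro k hqk hkn
    rcases hkn.eq_or_lt with rfl | hkn
    · exact hn
    by_contra hk
    have hkq : k ≠ q + 1 := by
      rintro rfl
      exact hk hq
    have h1 := hpmin p le_rfl
    have h2 := hqmin q hpq le_rfl
    have h3 := hb p q (q + 1) k hpq (by omega) (by omega) hkn (h1.trans hq.symm)
      (not_iff_not.1 ((not_iff.1 h2).trans (not_iff.1 hk).symm))
    exact h2 (h3.symm.trans h1)
  refine ⟨p, q, hpq, hqn, fun k hk => ?_⟩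
  have hval : ∀ k ≤ n, ¬ (b k ↔ b 0) ↔ p < k ∧ k ≤ q := by
    intro k hk
    by_cases h1 : k ≤ p
    · simp [hpmin k h1, h1]
    by_cases h2 : k ≤ q
    · simp [hqmin k (by omega) h2, h2]
      omega
    · simp [hafter k (by omega) hk, h2]
  have h1 := hval k (by omega)
  have h2 := hval (k + 1) (by omega)
  have h3 : (b k ↔ b (k + 1)) ↔ (¬ (b k ↔ b 0) ↔ ¬ (b (k + 1) ↔ b 0)) := by
    by_cases h : b 0 <;> simp [h, not_iff_not]
  rw [h3, h1, h2]
  omega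

variable [Fintype V] [DecidableEq V]

lemma crossSum_single (a b : V) (A B : Set V) :
    crossSum (fun x y => if x = a then if y = b then 1 else 0 else 0) A B =
      A.indicator 1 a * B.indicator 1 b := by
  rw [crossSum, Finset.sum_eq_single a, Finset.sum_eq_single b]
  · simp
  · intro y _ hy
    simp [hy]
  · simp
  · intro x _ hx
    simp [hx]
  · simp

lemma crossSum_edge {a b : V} (hab : a ≠ b) (S : Set V) [DecidablePred (· ∈ S)] :
    crossSum (fun x y => if s(a, b) = s(x, y) then 1 else 0) S Sᶜ =
      if a ∈ S ↔ b ∈ S then 0 else 1 := by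
  have h : (fun x y => if s(a, b) = s(x, y) then (1 : ℝ) else 0) = fun x y =>
      (if x = a then if y = b then 1 else 0 else 0) +
        if x = b then if y = a then 1 else 0 else 0 := by
    ext x y
    rcases eq_or_ne x a with rfl | h1
    · simp [hab, hab.symm, eq_comm]
    · rcases eq_or_ne x b with rfl | h2
      · simp [hab, hab.symm, eq_comm]
      · simp [h1, h2, h1.symm, h2.symm]
  rw [h, crossSum_add, crossSum_single, crossSum_single]
  by_cases ha : a ∈ S <;> by_cases hb : b ∈ S <;> simp [ha, hb]

/-- The weight of a cut with respect to the edge multiplicities of a walk is the number of steps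
of the walk crossing the cut. -/
lemma crossSum_count_edges {u w : V} (p : G.Walk u w) (S : Set V) [DecidablePred (· ∈ S)] :
    crossSum (fun x y => (p.edges.count s(x, y) : ℝ)) S Sᶜ =
      ∑ k ∈ range p.length, if p.getVert k ∈ S ↔ p.getVert (k + 1) ∈ S then 0 else 1 := by
  induction p with
  | nil => simp [crossSum]
  | @cons a b _ hab q ih =>
    rw [SimpleGraph.Walk.length_cons, Finset.sum_range_succ']
    have hcount : (fun x y => (((SimpleGraph.Walk.cons hab q).edges.count s(x, y) : ℕ) : ℝ)) =
        fun x y => (q.edges.count s(x, y) : ℝ) + if s(a, b) = s(x, y) then 1 else 0 := by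
      ext x y
      simp [List.count_cons]
    rw [hcount, crossSum_add, ih, crossSum_edge hab.ne]
    refine congrArg₂ _ rfl ?_
    congr 1
    simp

/-- A cut with connected sides meets a non-interleaved cycle in two edges if it separates
vertices of the cycle, and in no edge otherwise. -/
lemma crossSum_isCycle {c : G.Walk v v} (hc : c.IsCycle) (hni : ¬ IsInterleaved G c)
    (hS : LinkedSet G S) (hS' : LinkedSet G Sᶜ) :
    ((S ∩ {x | x ∈ c.support}).Nonempty → (Sᶜ ∩ {x | x ∈ c.support}).Nonempty →
      crossSum (fun x y => if s(x, y) ∈ c.edges then 1 else 0) S Sᶜ = 2) ∧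
    crossSum (fun x y => if s(x, y) ∈ c.edges then 1 else 0) S Sᶜ ≤ 2 := by
  classical
  have hcount : (fun x y => if s(x, y) ∈ c.edges then (1 : ℝ) else 0) =
      fun x y => (c.edges.count s(x, y) : ℝ) := by
    ext x y
    rw [List.Nodup.count hc.edges_nodup]
    simp
  have hn : c.getVert c.length ∈ S ↔ c.getVert 0 ∈ S := by simp
  have hlen := hc.three_le_length
  rw [hcount, crossSum_count_edges]
  by_cases hconst : ∃ m < c.length, ¬ (c.getVert m ∈ S ↔ c.getVert 0 ∈ S)
  · obtain ⟨m, hm, hmS⟩ := hconst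
    obtain ⟨p, q, hpq, hq, hchange⟩ := exists_two_changes (b := fun k => c.getVert k ∈ S) hn
      (fun i j k l hij hjk hkl hl hik hjl => by
        by_contra h
        by_cases hi : c.getVert i ∈ S
        · exact hni (isInterleaved_of_alternating c hS hS' hij hjk hkl hl hi (by tauto)
            (by tauto) (by tauto))
        · exact hni (isInterleaved_of_alternating (S := Sᶜ) c hS' (by rwa [compl_compl]) hij hjk
            hkl hl hi (by simp only [Set.mem_compl_iff]; tauto)
            (by simp only [Set.mem_compl_iff]; tauto) (by simp only [Set.mem_compl_iff]; tauto)))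
      hm hmS
    have hsum : ∑ k ∈ range c.length,
        (if c.getVert k ∈ S ↔ c.getVert (k + 1) ∈ S then (0 : ℝ) else 1) = 2 := by
      have hfilter : ({k ∈ range c.length | ¬ (c.getVert k ∈ S ↔ c.getVert (k + 1) ∈ S)}) =
          ({p, q} : Finset ℕ) := by
        ext k
        rw [Finset.mem_filter, Finset.mem_range, Finset.mem_insert, Finset.mem_singleton]
        constructor
        · exact fun h => (hchange k h.1).1 h.2
        · intro h
          have hk : k < c.length := by omega
          exact ⟨hk, (hchange k hk).2 h⟩
      simp_rw [← ite_not (_ ↔ _)]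
      rw [← Finset.sum_filter, hfilter, Finset.sum_const, Finset.card_pair hpq.ne]
      norm_num
    exact ⟨fun _ _ => hsum, hsum.le⟩
  · push Not at hconst
    have hconst' : ∀ k ≤ c.length, c.getVert k ∈ S ↔ c.getVert 0 ∈ S := fun k hk => by
      rcases hk.eq_or_lt with rfl | hk
      · exact hn
      · exact hconst k hk
    constructor
    · rintro ⟨x, hxS, hx⟩ ⟨y, hyS, hy⟩
      obtain ⟨i, rfl, hi⟩ := SimpleGraph.Walk.mem_support_iff_exists_getVert.1 hx
      obtain ⟨j, rfl, hj⟩ := SimpleGraph.Walk.mem_support_iff_exists_getVert.1 hy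
      exact absurd ((hconst' j hj).2 ((hconst' i hi).1 hxS)) hyS
    · rw [Finset.sum_eq_zero]
      · norm_num
      · intro k hk
        rw [Finset.mem_range] at hk
        rw [if_pos]
        rw [hconst' k hk.le, hconst' (k + 1) hk]

end Cycle

section Dimension

variable {ι E : Type*} [Fintype ι] [AddCommGroup E] [Module ℝ E]

lemma isLinearMap_dot (a : ι → ℝ) : IsLinearMap ℝ (dot a) where
  map_add x y := by simp [dot, mul_add, Finset.sum_add_distrib]
  map_smul r x := by simp [dot, Finset.mul_sum, mul_left_comm]

/-- A set on which no nonzero functional `dot b` vanishes spans. -/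
lemma span_eq_top_of_dot {F : Set (ι → ℝ)}
    (hF : ∀ b : ι → ℝ, (∀ x ∈ F, dot b x = 0) → b = 0) : Submodule.span ℝ F = ⊤ := by
  classical
  by_contra hne
  obtain ⟨f, hf, hle⟩ := Submodule.exists_le_ker_of_lt_top _ (lt_top_iff_ne_top.2 hne)
  have hdot : ∀ x, f x = dot (fun i => f (Pi.single i 1)) x := fun x => by
    conv_lhs => rw [LinearMap.pi_apply_eq_sum_univ f x]
    simp only [dot, smul_eq_mul, mul_comm]
    refine Finset.sum_congr rfl fun i _ => ?_
    congr 3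
    ext j
    simp [Pi.single_apply, eq_comm]
  have h0 := hF _ fun x hx => (hdot x).symm.trans (hle (Submodule.subset_span hx))
  refine hf (LinearMap.ext fun x => ?_)
  rw [hdot, h0]
  simp [dot]

lemma affDim_of_zero_mem {P F : Set E} (h0 : (0 : E) ∈ P) (hFP : F ⊆ P)
    (hspan : Submodule.span ℝ F = ⊤) : affDim P = Module.finrank ℝ E := by
  have htop : vectorSpan ℝ P = ⊤ := by
    rw [eq_top_iff, ← hspan]
    refine Submodule.span_le.2 fun x hx => ?_
    simpa using vsub_mem_vectorSpan ℝ (hFP hx) h0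
  rw [affDim, htop, finrank_top]

lemma affDim_add_one_of_span_eq_top [FiniteDimensional ℝ E] {F : Set E} {f : E →ₗ[ℝ] ℝ} {r : ℝ} (hr : r ≠ 0)
    (hf : ∀ x ∈ F, f x = r) (hF : F.Nonempty) (hspan : Submodule.span ℝ F = ⊤) :
    affDim F + 1 = Module.finrank ℝ E := by
  obtain ⟨y, hy⟩ := hF
  have hle : vectorSpan ℝ F ≤ LinearMap.ker f := by
    refine Submodule.span_le.2 ?_
    rintro _ ⟨x, hx, z, hz, rfl⟩
    simp [hf x hx, hf z hz]
  have hne : vectorSpan ℝ F ≠ ⊤ := fun h => by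
    have : y ∈ LinearMap.ker f := hle (h ▸ Submodule.mem_top)
    exact hr ((hf y hy).symm.trans this)
  have hlt := Submodule.finrank_lt hne
  have hsup : vectorSpan ℝ F ⊔ Submodule.span ℝ {y} = ⊤ := by
    rw [eq_top_iff, ← hspan]
    refine Submodule.span_le.2 fun x hx => ?_
    rw [SetLike.mem_coe, ← sub_add_cancel x y]
    exact Submodule.add_mem_sup (vsub_mem_vectorSpan ℝ hx hy) (Submodule.mem_span_singleton_self y)
  have h1 := Submodule.finrank_add_le_finrank_add_finrank (vectorSpan ℝ F) (Submodule.span ℝ {y})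
  rw [hsup, finrank_top] at h1
  have h2 : Module.finrank ℝ (Submodule.span ℝ {y}) ≤ 1 := by
    simpa using finrank_span_le_card (R := ℝ) ({y} : Set E)
  unfold affDim
  omega

end Dimension

section Facet

variable {V : Type*} {G : SimpleGraph V}

lemma indVec_mem_bondPolytope {S : Set V} (hS : LinkedSet G S) (hS' : LinkedSet G Sᶜ) :
    indVec G (cut G S) ∈ bondPolytope G :=
  subset_convexHull _ _ ⟨_, ⟨S, rfl, linkedSet_iff_preconnected.1 hS,
    linkedSet_iff_preconnected.1 hS'⟩, rfl⟩

lemma three_le_ncard_support [Finite V] {v : V} {c : G.Walk v v} (hc : c.IsCycle) :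
    3 ≤ {x | x ∈ c.support}.ncard := by
  classical
  have h1 : ((c.support.tail.toFinset : Finset V) : Set V) ⊆ {x | x ∈ c.support} := fun x hx =>
    List.mem_of_mem_tail (by simpa using hx)
  have h2 := Set.ncard_le_ncard h1
  rw [Set.ncard_coe_finset, List.toFinset_card_of_nodup hc.support_nodup, List.length_tail,
    SimpleGraph.Walk.length_support] at h2
  have := hc.three_le_length
  omega

variable [DecidableEq V] [Fintype G.edgeSet]

/-- The symmetric function on pairs of vertices given by a vector of edge weights. -/
noncomputable def pairWeight (a : G.edgeSet → ℝ) (x y : V) : ℝ :=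
  ∑ e, a e * if (e : Sym2 V) = s(x, y) then 1 else 0

lemma pairWeight_comm (a : G.edgeSet → ℝ) (x y : V) : pairWeight a x y = pairWeight a y x := by
  rw [pairWeight, Sym2.eq_swap]
  rfl

lemma pairWeight_adj (a : G.edgeSet → ℝ) {x y : V} (h : s(x, y) ∈ G.edgeSet) :
    pairWeight a x y = a ⟨s(x, y), h⟩ := by
  rw [pairWeight, Finset.sum_eq_single ⟨s(x, y), h⟩]
  · simp
  · intro e _ he
    rw [if_neg fun h' => he (Subtype.ext h'), mul_zero]
  · simp

lemma pairWeight_not_adj (a : G.edgeSet → ℝ) {x y : V} (h : ¬ G.Adj x y) :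
    pairWeight a x y = 0 := by
  refine Finset.sum_eq_zero fun e _ => ?_
  rw [if_neg, mul_zero]
  rintro he
  exact h (he ▸ e.2 : s(x, y) ∈ G.edgeSet)

/-- The value of a linear functional on a cut vector. -/
lemma dot_indVec_cut [Fintype V] (a : G.edgeSet → ℝ) (S : Set V) :
    dot a (indVec G (cut G S)) = crossSum (pairWeight a) S Sᶜ := by
  classical
  have hsum := crossSum_sum univ a (fun e x y => if (e : Sym2 V) = s(x, y) then 1 else 0) S Sᶜ
  change crossSum (pairWeight a) S Sᶜ = _ at hsum
  rw [hsum, dot]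
  refine Finset.sum_congr rfl fun e _ => ?_
  congr 1
  obtain ⟨e, he⟩ := e
  induction e with
  | h u w =>
    rw [crossSum_edge (SimpleGraph.ne_of_adj G he), indVec]
    have hmem : s(u, w) ∈ cut G S ↔ ¬ (u ∈ S ↔ w ∈ S) := by
      constructor
      · rintro ⟨-, x, y, hxy, hx, hy⟩
        rcases Sym2.eq_iff.1 hxy with ⟨rfl, rfl⟩ | ⟨rfl, rfl⟩ <;> tauto
      · intro h
        refine ⟨he, ?_⟩
        by_cases hu : u ∈ S
        · exact ⟨u, w, rfl, hu, by tauto⟩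
        · exact ⟨w, u, Sym2.eq_swap, by tauto, hu⟩
    simp only [hmem, ite_not]

end Facet

theorem noninterleaved_cycle_facet {V : Type*} [Fintype V] [DecidableEq V]
    (G : SimpleGraph V) [DecidableRel G.Adj] (h3 : ThreeConnected G)
    (v : V) (c : G.Walk v v) (hc : c.IsCycle) (hni : ¬ IsInterleaved G c) :
    IsFacet (bondPolytope G)
      (fun e => if (e : Sym2 V) ∈ c.edges then (1 : ℝ) else 0) 2 := by
  have hG : ∀ W : Set V, W.ncard ≤ 2 → LinkedSet G Wᶜ := fun W hW =>
    linkedSet_iff_preconnected.2 (h3.2 W hW).preconnected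
  set a : G.edgeSet → ℝ := fun e => if (e : Sym2 V) ∈ c.edges then (1 : ℝ) else 0 with ha
  set C : Set V := {x | x ∈ c.support} with hC
  have hC3 : 3 ≤ C.ncard := three_le_ncard_support hc
  have hκ_eq : pairWeight a = fun x y => if s(x, y) ∈ c.edges then 1 else 0 := by
    ext x y
    by_cases hxy : G.Adj x y
    · rw [pairWeight_adj a hxy]
    · rw [pairWeight_not_adj a hxy, if_neg fun h => hxy (c.adj_of_mem_edges h)]
  have hκ : IsRing G C (pairWeight a) := by
    refine ⟨pairWeight_comm a, fun x hx y => ?_, fun x y => pairWeight_not_adj a, fun S hS => ?_⟩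
    · rw [hκ_eq]
      exact if_neg fun h => hx (c.fst_mem_support_of_mem_edges h)
    · rw [hκ_eq]
      exact (crossSum_isCycle hc hni hS.linked hS.linked_compl).1 hS.meets hS.meets_compl
  set F : Set (G.edgeSet → ℝ) := {x ∈ bondPolytope G | dot a x = 2} with hF
  have hmemF : ∀ S, Splits G C S → indVec G (cut G S) ∈ F := fun S hS =>
    ⟨indVec_mem_bondPolytope hS.linked hS.linked_compl, by
      rw [dot_indVec_cut, hκ.crossSum_eq S hS]⟩
  have hFne : F.Nonempty := ⟨_, hmemF {v} (splits_singleton hG hC3 c.start_mem_support)⟩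
  have hspan : Submodule.span ℝ F = ⊤ := by
    refine span_eq_top_of_dot fun b hb => ?_
    have hnull : IsNull G C (pairWeight b) :=
      ⟨pairWeight_comm b, fun x y => pairWeight_not_adj b, fun S hS => by
        rw [← dot_indVec_cut]
        exact hb _ (hmemF S hS)⟩
    ext ⟨e, he⟩
    induction e with
    | h x y =>
      rw [← pairWeight_adj b he]
      exact hnull.eq_zero hG hC3 hκ x y
  have hzero : (0 : G.edgeSet → ℝ) ∈ bondPolytope G := by
    have h : indVec G (cut G ∅) = 0 := by
      ext e
      simp [indVec, cut]
    rw [← h]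
    refine indVec_mem_bondPolytope (fun u hu => hu.elim) ?_
    exact hG ∅ (by simp)
  refine ⟨fun h => ?_, fun x hx => ?_, hFne, ?_⟩
  · obtain ⟨x, hx⟩ := hFne
    have h2 := hx.2
    rw [h] at h2
    simp [dot] at h2
  · have hhalf : Convex ℝ {x | dot a x ≤ 2} := convex_halfSpace_le (isLinearMap_dot a) 2
    refine convexHull_min ?_ hhalf hx
    rintro _ ⟨_, ⟨S, rfl, hS, hS'⟩, rfl⟩
    change dot a (indVec G (cut G S)) ≤ 2
    rw [dot_indVec_cut, hκ_eq]
    exact (crossSum_isCycle hc hni (linkedSet_iff_preconnected.2 hS)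
      (linkedSet_iff_preconnected.2 hS')).2
  · rw [affDim_of_zero_mem hzero (fun x hx => hx.1) hspan]
    exact affDim_add_one_of_span_eq_top (f := (isLinearMap_dot a).mk') two_ne_zero
      (fun x hx => hx.2) hFne hspan

end BondPolytope
end

section
/- Let G be a finite simple connected graph and let C be a cycle in G. If the inequality ∑_{e ∈ E(C)} x_e ≤ 2 is facet-defining for BOND(G), then C is maximal non-interleaved, i.e., C is non-interleaved and there is no non-interleaved cycle C′ in G with |E(C) ∖ E(C′)| = 1. -/
open Finset

namespace BondPolytope

variable {V : Type*}

section Sequences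

open Classical in
/-- The positions `i < n` at which the Boolean sequence `s` changes its value. -/
noncomputable def changes (s : ℕ → Prop) (n : ℕ) : Finset ℕ :=
  {i ∈ range n | ¬(s i ↔ s (i + 1))}

/-- The Boolean sequence `s` takes alternating values at four positions below `n`. -/
def Alternates (s : ℕ → Prop) (n : ℕ) : Prop :=
  ∃ i j k l, i < j ∧ j < k ∧ k < l ∧ l < n ∧ ¬(s i ↔ s j) ∧ ¬(s j ↔ s k) ∧ ¬(s k ↔ s l)

lemma mem_changes {s : ℕ → Prop} {n i : ℕ} :
    i ∈ changes s n ↔ i < n ∧ ¬(s i ↔ s (i + 1)) := by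
  simp [changes]

lemma exists_change {s : ℕ → Prop} {a b : ℕ} (hab : a < b) (h : ¬(s a ↔ s b)) :
    ∃ i, a ≤ i ∧ i < b ∧ ¬(s i ↔ s (i + 1)) := by
  by_contra! hc
  refine h ?_
  clear h
  induction b, hab.le using Nat.le_induction with
  | base => rfl
  | succ b hb ih =>
    rcases hb.eq_or_lt with rfl | hb'
    · exact hc a le_rfl (by omega)
    · exact (ih hb' fun i h1 h2 => hc i h1 (by omega)).trans (hc b hb (by omega))

lemma Alternates.two_lt_card_changes {s : ℕ → Prop} {n : ℕ} (h : Alternates s n) :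
    2 < #(changes s n) := by
  obtain ⟨i, j, k, l, hij, hjk, hkl, hln, h1, h2, h3⟩ := h
  obtain ⟨a, ha, ha', hac⟩ := exists_change hij h1
  obtain ⟨b, hb, hb', hbc⟩ := exists_change hjk h2
  obtain ⟨d, hd, hd', hdc⟩ := exists_change hkl h3
  rw [two_lt_card]
  exact ⟨a, mem_changes.2 ⟨by omega, hac⟩, b, mem_changes.2 ⟨by omega, hbc⟩,
    d, mem_changes.2 ⟨by omega, hdc⟩, by omega, by omega, by omega⟩

/-- A closed Boolean sequence which changes but does not alternate changes exactly twice. -/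
lemma card_changes_eq_two {s : ℕ → Prop} {n : ℕ} (hs : s 0 ↔ s n)
    (hne : (changes s n).Nonempty) (h : ¬ Alternates s n) : #(changes s n) = 2 := by
  classical
  set T : Finset ℕ := {i ∈ range n | ¬(s i ↔ s 0)} with hT
  have memT : ∀ i, i ∈ T ↔ i < n ∧ ¬(s i ↔ s 0) := by simp [hT]
  have hTne : T.Nonempty := by
    obtain ⟨i, hi⟩ := hne
    rw [mem_changes] at hi
    by_contra hTe
    rw [not_nonempty_iff_eq_empty] at hTe
    have hc : ∀ i ≤ n, s i ↔ s 0 := by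
      intro i hi
      rcases hi.eq_or_lt with rfl | hi
      · exact hs.symm
      · by_contra hne
        have := (memT i).2 ⟨hi, hne⟩
        simp [hTe] at this
    exact hi.2 ((hc i hi.1.le).trans (hc (i + 1) hi.1).symm)
  set m := T.min' hTne with hm
  set M := T.max' hTne with hM
  have hmT := (memT m).1 (T.min'_mem hTne)
  have hMT := (memT M).1 (T.max'_mem hTne)
  have hmM : m ≤ M := T.min'_le_max' hTne
  have hm0 : 0 < m := by
    rcases Nat.eq_zero_or_pos m with h0 | h0
    · exact absurd (by rw [h0]) hmT.2
    · exact h0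
  have key : ∀ i ≤ n, ¬(s i ↔ s 0) ↔ m ≤ i ∧ i ≤ M := by
    intro i hi
    constructor
    · intro hsi
      rcases hi.eq_or_lt with rfl | hi
      · exact absurd hs.symm hsi
      · have := (memT i).2 ⟨hi, hsi⟩
        exact ⟨T.min'_le _ this, T.le_max' _ this⟩
    · rintro ⟨h1, h2⟩ hsi
      rcases h1.eq_or_lt with h1 | h1
      · exact hmT.2 (h1 ▸ hsi)
      rcases h2.eq_or_lt with h2 | h2
      · exact hMT.2 (h2 ▸ hsi)
      exact h ⟨0, m, i, M, hm0, h1, h2, hMT.1, by tauto, by tauto, by tauto⟩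
  have : changes s n = {m - 1, M} := by
    ext i
    rw [mem_changes, mem_insert, mem_singleton]
    constructor
    · rintro ⟨hi, hc⟩
      by_contra hcon
      have hiff : (m ≤ i ∧ i ≤ M) ↔ (m ≤ i + 1 ∧ i + 1 ≤ M) := by omega
      rw [← key i hi.le, ← key (i + 1) hi, not_iff_not] at hiff
      by_cases h0 : s 0 <;> simp only [h0, iff_true, iff_false, not_iff_not] at hiff <;>
        exact hc hiff
    · intro hi
      have hin : i < n := by omega
      refine ⟨hin, fun hiff => ?_⟩
      have h1 : (m ≤ i ∧ i ≤ M) ↔ (m ≤ i + 1 ∧ i + 1 ≤ M) := by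
        rw [← key i hin.le, ← key (i + 1) hin, hiff]
      omega
  rw [this, card_pair (by omega)]

end Sequences

section Cycles

variable {G : SimpleGraph V}

lemma mk_mem_cut {S : Set V} {x y : V} :
    s(x, y) ∈ cut G S ↔ G.Adj x y ∧ ¬(x ∈ S ↔ y ∈ S) := by
  simp only [cut, Set.mem_ofPred_eq, SimpleGraph.mem_edgeSet, and_congr_right_iff]
  intro _
  constructor
  · rintro ⟨u, w, h, hu, hw⟩
    rcases Sym2.eq_iff.1 h with ⟨rfl, rfl⟩ | ⟨rfl, rfl⟩ <;> tauto
  · intro h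
    by_cases hx : x ∈ S
    · exact ⟨x, y, rfl, hx, by tauto⟩
    · exact ⟨y, x, Sym2.eq_swap, by tauto, hx⟩

lemma edges_getElem_eq_getVert {u w : V} (p : G.Walk u w) {i : ℕ} (hi : i < p.edges.length) :
    p.edges[i] = s(p.getVert i, p.getVert (i + 1)) := by
  rw [SimpleGraph.Walk.getElem_edges_eq_edge_getElem_darts, SimpleGraph.Walk.darts_getElem_eq_getVert]
  rfl

/-- The number of edges in which a cut meets a cycle is the number of side changes along it. -/
lemma ncard_edges_inter_cut {v : V} {c : G.Walk v v} (hc : c.IsCycle) (S : Set V) :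
    ({e | e ∈ c.edges} ∩ cut G S).ncard = #(changes (fun i => c.getVert i ∈ S) c.length) := by
  have himg : {e | e ∈ c.edges} ∩ cut G S =
      (fun i => s(c.getVert i, c.getVert (i + 1))) ''
        (changes (fun i => c.getVert i ∈ S) c.length : Set ℕ) := by
    ext e
    simp only [Set.mem_inter_iff, Set.mem_ofPred_eq, Set.mem_image, mem_coe, mem_changes]
    constructor
    · rintro ⟨he, hS⟩
      obtain ⟨i, hi, rfl⟩ := List.getElem_of_mem he
      rw [edges_getElem_eq_getVert, mk_mem_cut] at hS
      exact ⟨i, ⟨by simpa using hi, hS.2⟩, (edges_getElem_eq_getVert c hi).symm⟩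
    · rintro ⟨i, ⟨hi, hS⟩, rfl⟩
      refine ⟨?_, mk_mem_cut.2 ⟨c.adj_getVert_succ hi, hS⟩⟩
      rw [← edges_getElem_eq_getVert c (by simpa using hi)]
      exact List.getElem_mem _
  rw [himg, Set.InjOn.ncard_image, Set.ncard_coe_finset]
  intro i hi j hj hij
  have hi' : i < c.edges.length := by simpa using (mem_changes.1 hi).1
  have hj' : j < c.edges.length := by simpa using (mem_changes.1 hj).1
  simp only [← edges_getElem_eq_getVert c hi', ← edges_getElem_eq_getVert c hj'] at hij
  exact (hc.edges_nodup.getElem_inj_iff).1 hij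

/-- Two disjoint paths off the cycle whose ends cross along the cycle make it interleaved. -/
lemma isInterleaved_of_crossing {v : V} {c : G.Walk v v} {i j p q : ℕ}
    (hip : i < p) (hpj : p < j) (hj : j < c.length) (hq : q < c.length) (hout : q < i ∨ j < q)
    (q₁ : (G.deleteEdges {e | e ∈ c.edges}).Walk (c.getVert i) (c.getVert j))
    (q₂ : (G.deleteEdges {e | e ∈ c.edges}).Walk (c.getVert p) (c.getVert q))
    (h₁ : q₁.IsPath) (h₂ : q₂.IsPath) (hd : ∀ x ∈ q₁.support, x ∉ q₂.support) :
    IsInterleaved G c := by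
  rcases hout with hout | hout
  · exact ⟨q, i, p, j, hout, hip, hpj, hj, q₂.reverse, q₁, h₂.reverse, h₁,
      fun x hx hx' => hd x hx' (by simpa using hx)⟩
  · exact ⟨i, p, j, q, hip, hpj, hout, hq, q₁, q₂, h₁, h₂, hd⟩

/-- If `G[S]` is connected, contains cycle vertices on both of the arcs cut out by the `i`-th
and the `j`-th cycle vertices, but none of these two vertices, then the two arcs are joined
within `S` by a path avoiding the edges of the cycle. -/
lemma exists_path_between_arcs {v : V} (c : G.Walk v v) {S : Set V}
    (hS : (G.induce S).Preconnected) {i j p q : ℕ}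
    (hiS : c.getVert i ∉ S) (hjS : c.getVert j ∉ S) (hip : i < p) (hpj : p < j)
    (hpS : c.getVert p ∈ S) (hq : q < c.length) (hout : q < i ∨ j < q) (hqS : c.getVert q ∈ S) :
    ∃ p' q', i < p' ∧ p' < j ∧ q' < c.length ∧ (q' < i ∨ j < q') ∧
      ∃ w : (G.deleteEdges {e | e ∈ c.edges}).Walk (c.getVert p') (c.getVert q'),
        w.IsPath ∧ ∀ x ∈ w.support, x ∈ S := by
  set H := G.deleteEdges {e | e ∈ c.edges} with hH
  set X : Set V := {x | ∃ p, i < p ∧ p < j ∧ c.getVert p = x} with hX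
  set Y : Set V := {y | ∃ q, q < c.length ∧ (q < i ∨ j < q) ∧ c.getVert q = y} with hY
  have hedge : ∀ a b : V, a ∈ S → b ∈ S → s(a, b) ∈ c.edges → a ∈ Y ∨ b ∈ X := by
    intro a b ha hb hab
    obtain ⟨k, hk, hkab⟩ := List.getElem_of_mem hab
    rw [edges_getElem_eq_getVert] at hkab
    have hk : k < c.length := by simpa using hk
    have hkS : c.getVert k ∈ S ∧ c.getVert (k + 1) ∈ S := by
      rcases Sym2.eq_iff.1 hkab with ⟨h1, h2⟩ | ⟨h1, h2⟩ <;> simp [h1, h2, ha, hb]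
    have n1 : k ≠ i := fun h => hiS (h ▸ hkS.1)
    have n2 : k ≠ j := fun h => hjS (h ▸ hkS.1)
    have n3 : k + 1 ≠ i := fun h => hiS (h ▸ hkS.2)
    have n4 : k + 1 ≠ j := fun h => hjS (h ▸ hkS.2)
    by_cases hin : i < k ∧ k < j
    · right
      rcases Sym2.eq_iff.1 hkab with ⟨h1, h2⟩ | ⟨h1, h2⟩
      · exact ⟨k + 1, by omega, by omega, h2⟩
      · exact ⟨k, by omega, by omega, h1⟩
    · left
      rcases Sym2.eq_iff.1 hkab with ⟨h1, h2⟩ | ⟨h1, h2⟩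
      · exact ⟨k, by omega, by omega, h1⟩
      · rcases Nat.lt_or_ge (k + 1) c.length with hlt | hge
        · exact ⟨k + 1, by omega, by omega, h2⟩
        · have hkn : k + 1 = c.length := by omega
          have h0 : c.getVert 0 = c.getVert (k + 1) := by
            rw [hkn, c.getVert_length, c.getVert_zero]
          have n5 : i ≠ 0 := by
            rintro rfl
            exact hiS (h0 ▸ hkS.2)
          exact ⟨0, by omega, by omega, h0.trans h2⟩
  have main : ∀ {a y : S} (_ : (G.induce S).Walk a y), (y : V) ∈ Y →
      ∀ x : S, (x : V) ∈ X → (H.induce S).Reachable x a →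
        ∃ x' y' : S, (x' : V) ∈ X ∧ (y' : V) ∈ Y ∧ (H.induce S).Reachable x' y' := by
    intro a y W hy
    induction W with
    | nil => exact fun x hx hr => ⟨x, _, hx, hy, hr⟩
    | @cons a b y hab W ih =>
      intro x hx hr
      by_cases he : s((a : V), (b : V)) ∈ c.edges
      · rcases hedge a b a.2 b.2 he with h | h
        · exact ⟨x, a, hx, h, hr⟩
        · exact ih hy b h (SimpleGraph.Reachable.refl _)
      · refine ih hy x hx (hr.trans (SimpleGraph.Adj.reachable ?_))
        have hab' : G.Adj a b := hab
        simp [hH, hab', he]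
  obtain ⟨W⟩ := hS ⟨_, hpS⟩ ⟨_, hqS⟩
  obtain ⟨⟨x, hxS⟩, ⟨y, hyS⟩, ⟨p', hp1, hp2, hp3⟩, ⟨q', hq1, hq2, hq3⟩, hr⟩ :=
    main W ⟨q, hq, hout, rfl⟩ _ ⟨p, hip, hpj, rfl⟩ (SimpleGraph.Reachable.refl _)
  obtain ⟨w, hw⟩ := hr.exists_isPath
  dsimp only at hp3 hq3
  subst hp3 hq3
  refine ⟨p', q', hp1, hp2, hq1, hq2, w.map (SimpleGraph.Embedding.induce (G := H) S).toHom, ?_, ?_⟩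
  · exact SimpleGraph.Walk.IsPath.map (SimpleGraph.Embedding.induce (G := H) S).injective hw
  · intro z hz
    obtain ⟨z', -, rfl⟩ := List.mem_map.1 (SimpleGraph.Walk.support_map _ w ▸ hz)
    exact z'.2

lemma isInterleaved_of_alternates {v : V} {c : G.Walk v v} {S : Set V}
    (hS : (G.induce S).Preconnected) (hS' : (G.induce Sᶜ).Preconnected)
    (h : Alternates (fun i => c.getVert i ∈ S) c.length) : IsInterleaved G c := by
  obtain ⟨i₁, i₂, i₃, i₄, h12, h23, h34, h4, c1, c2, c3⟩ := h
  dsimp only at c1 c2 c3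
  wlog h1 : c.getVert i₁ ∈ S generalizing S
  · refine this hS' (by rwa [compl_compl]) ?_ ?_ ?_ h1 <;>
      simp only [Set.mem_compl_iff] <;> tauto
  have h2 : c.getVert i₂ ∉ S := by tauto
  have h3 : c.getVert i₃ ∈ S := by tauto
  have h4' : c.getVert i₄ ∉ S := by tauto
  obtain ⟨p, q, hp1, hp2, hq1, hq2, w, hw, hwS⟩ := exists_path_between_arcs c hS
    h2 h4' h23 h34 h3 (by omega) (Or.inl h12) h1
  have hpS : c.getVert p ∉ Sᶜ := fun h => h (hwS _ w.start_mem_support)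
  have hqS : c.getVert q ∉ Sᶜ := fun h => h (hwS _ w.end_mem_support)
  rcases hq2 with hq2 | hq2
  · obtain ⟨p', q', hp1', hp2', hq1', hq2', w', hw', hwS'⟩ := exists_path_between_arcs c hS'
      hqS hpS hq2 hp1 h2 h4 (Or.inr hp2) h4'
    exact isInterleaved_of_crossing hp1' hp2' (by omega) hq1' hq2' w.reverse w' hw.reverse hw'
      fun x hx hx' => hwS' x hx' (hwS x (by simpa using hx))
  · obtain ⟨p', q', hp1', hp2', hq1', hq2', w', hw', hwS'⟩ := exists_path_between_arcs c hS'
      hpS hqS hp2 hq2 h4' (by omega) (Or.inl hp1) h2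
    exact isInterleaved_of_crossing hp1' hp2' (by omega) hq1' hq2' w w' hw hw'
      fun x hx hx' => hwS' x hx' (hwS x hx)

/-- A bond meeting a non-interleaved cycle meets it in exactly two edges. -/
lemma ncard_edges_inter_eq_two {v : V} {c : G.Walk v v} (hc : c.IsCycle)
    (hni : ¬ IsInterleaved G c) {D : Set (Sym2 V)} (hD : IsBond G D)
    (hne : ({e | e ∈ c.edges} ∩ D).Nonempty) : ({e | e ∈ c.edges} ∩ D).ncard = 2 := by
  obtain ⟨S, rfl, hS, hS'⟩ := hD
  have hfin : ({e | e ∈ c.edges} ∩ cut G S).Finite :=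
    (List.finite_toSet c.edges).inter_of_left _
  have hpos := (Set.ncard_pos hfin).2 hne
  rw [ncard_edges_inter_cut hc] at hpos ⊢
  exact card_changes_eq_two (by simp) (card_pos.1 hpos)
    fun h => hni (isInterleaved_of_alternates hS hS' h)

end Cycles

section Bonds

variable {G : SimpleGraph V}

/-- In a connected graph, two disjoint connected vertex sets are separated by a bond. -/
lemma exists_separating_preconnected [Finite V] (hG : G.Connected) {A B : Set V}
    (hA : (G.induce A).Preconnected) (hB : (G.induce B).Preconnected) (hne : (A ∪ B).Nonempty)
    (hAB : Disjoint A B) :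
    ∃ S, A ⊆ S ∧ Disjoint S B ∧ (G.induce S).Preconnected ∧ (G.induce Sᶜ).Preconnected := by
  induction hn : (A ∪ B)ᶜ.ncard using Nat.strong_induction_on generalizing A B with
  | _ n ih =>
    by_cases hU : A ∪ B = Set.univ
    · have : Aᶜ = B := by
        ext x
        have h1 : x ∈ A ∪ B := hU ▸ Set.mem_univ x
        have h2 : x ∈ A → x ∉ B := fun h => Set.disjoint_left.1 hAB h
        simp only [Set.mem_compl_iff]
        rcases h1 with h | h <;> tauto
      exact ⟨A, subset_rfl, hAB, hA, this ▸ hB⟩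
    · obtain ⟨y, hy⟩ := (Set.ne_univ_iff_exists_notMem _).1 hU
      obtain ⟨x, hx⟩ := hne
      obtain ⟨W⟩ := hG.preconnected x y
      obtain ⟨d, -, hd1, hd2⟩ := W.exists_boundary_dart _ hx hy
      have hadj : G.Adj d.fst d.snd := d.adj
      have grow : ∀ T : Set V, (G.induce T).Preconnected → d.fst ∈ T →
          (G.induce (insert d.snd T)).Preconnected := by
        intro T hT hdT
        have := SimpleGraph.induce_union_connected
          (SimpleGraph.induce_pair_connected_of_adj hadj).preconnected hT ⟨d.fst, by simp, hdT⟩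
        have heq : insert d.snd T = {d.fst, d.snd} ∪ T := by
          ext z
          simp only [Set.mem_insert_iff, Set.mem_union, Set.mem_singleton_iff]
          constructor
          · tauto
          · rintro ((rfl | h) | h) <;> tauto
        rw [heq]
        exact this.preconnected
      have hd2' : d.snd ∉ A ∧ d.snd ∉ B := by simpa using hd2
      have hlt : (insert d.snd (A ∪ B))ᶜ.ncard < n := by
        rw [← hn]
        refine Set.ncard_lt_ncard ?_ (Set.toFinite _)
        rw [Set.ssubset_def]
        exact ⟨Set.compl_subset_compl.2 (Set.subset_insert _ _),
          fun h => h (show d.snd ∈ (A ∪ B)ᶜ from hd2) (Set.mem_insert _ _)⟩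
      rcases hd1 with hd1 | hd1
      · obtain ⟨S, h1, h2, h3, h4⟩ := ih _ hlt (A := insert d.snd A) (B := B)
          (grow A hA hd1) hB ⟨d.fst, by simp [hd1]⟩
          (Set.disjoint_insert_left.2 ⟨hd2'.2, hAB⟩) (by rw [Set.insert_union])
        exact ⟨S, (Set.subset_insert _ _).trans h1, h2, h3, h4⟩
      · obtain ⟨S, h1, h2, h3, h4⟩ := ih _ hlt (A := A) (B := insert d.snd B)
          hA (grow B hB hd1) ⟨d.fst, by simp [hd1]⟩
          (Set.disjoint_insert_right.2 ⟨hd2'.1, hAB⟩) (by rw [Set.union_insert])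
        exact ⟨S, h1, h2.mono_right (Set.subset_insert _ _), h3, h4⟩

/-- An interleaved cycle is met by some bond in more than two edges. -/
lemma exists_bond_two_lt_ncard [Finite V] (hG : G.Connected) {v : V} {c : G.Walk v v}
    (hc : c.IsCycle) (h : IsInterleaved G c) :
    ∃ D, IsBond G D ∧ 2 < ({e | e ∈ c.edges} ∩ D).ncard := by
  obtain ⟨i₁, i₂, i₃, i₄, h12, h23, h34, h4, q₁, q₂, -, -, hd⟩ := h
  have hle : G.deleteEdges {e | e ∈ c.edges} ≤ G := SimpleGraph.deleteEdges_le _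
  have hq₁ := (q₁.mapLe hle).connected_induce_support.preconnected
  have hq₂ := (q₂.mapLe hle).connected_induce_support.preconnected
  rw [SimpleGraph.Walk.support_mapLe_eq_support] at hq₁ hq₂
  obtain ⟨S, h1, h2, hS, hS'⟩ := exists_separating_preconnected hG hq₁ hq₂
    ⟨_, Or.inl q₁.start_mem_support⟩ (Set.disjoint_left.2 hd)
  refine ⟨_, ⟨S, rfl, hS, hS'⟩, ?_⟩
  rw [ncard_edges_inter_cut hc]
  have m1 : c.getVert i₁ ∈ S := h1 q₁.start_mem_support
  have m3 : c.getVert i₃ ∈ S := h1 q₁.end_mem_support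
  have m2 : c.getVert i₂ ∉ S := fun h => Set.disjoint_left.1 h2 h q₂.start_mem_support
  have m4 : c.getVert i₄ ∉ S := fun h => Set.disjoint_left.1 h2 h q₂.end_mem_support
  exact Alternates.two_lt_card_changes
    ⟨i₁, i₂, i₃, i₄, h12, h23, h34, h4, by tauto, by tauto, by tauto⟩

lemma isBond_empty (hG : G.Connected) : IsBond G ∅ := by
  refine ⟨∅, ?_, fun x => x.2.elim, ?_⟩
  · ext e
    simp [cut]
  · rw [Set.compl_empty]
    exact (SimpleGraph.induceUnivIso G).symm.preconnected_iff.1 hG.preconnected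

lemma card_support_toFinset [DecidableEq V] {v : V} {c : G.Walk v v} (hc : c.IsCycle) :
    #c.support.toFinset = #c.edges.toFinset := by
  rw [List.toFinset_card_of_nodup hc.edges_nodup, SimpleGraph.Walk.length_edges]
  have h : c.support.toFinset = c.support.tail.toFinset := by
    ext x
    rw [List.mem_toFinset, List.mem_toFinset]
    refine ⟨fun hx => ?_, List.mem_of_mem_tail⟩
    rcases (SimpleGraph.Walk.mem_support_iff _).1 hx with rfl | hx
    · exact SimpleGraph.Walk.end_mem_tail_support hc.not_nil
    · exact hx
  rw [h, List.toFinset_card_of_nodup hc.support_nodup]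
  simp

lemma IsCycle.exists_edge_ne {v : V} {c : G.Walk v v} (hc : c.IsCycle) {u w : V}
    (hu : u ∈ c.support) : ∃ y, y ≠ w ∧ s(u, y) ∈ c.edges := by
  have h := hc.ncard_neighborSet_toSubgraph_eq_two hu
  obtain ⟨y, hy, hyw⟩ := Set.exists_ne_of_one_lt_ncard (h ▸ one_lt_two) w
  exact ⟨y, hyw, SimpleGraph.Walk.adj_toSubgraph_iff_mem_edges.1 hy⟩

lemma IsCycle.eq_of_mem_edges {v : V} {c : G.Walk v v} (hc : c.IsCycle) {u a b d : V}
    (ha : s(u, a) ∈ c.edges) (hb : s(u, b) ∈ c.edges) (hd : s(u, d) ∈ c.edges)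
    (hab : a ≠ b) (had : a ≠ d) : b = d := by
  have h := hc.ncard_neighborSet_toSubgraph_eq_two (c.fst_mem_support_of_mem_edges ha)
  by_contra hbd
  have hfin : (c.toSubgraph.neighborSet u).Finite := Set.finite_of_ncard_ne_zero (by omega)
  have : 2 < (c.toSubgraph.neighborSet u).ncard := (Set.two_lt_ncard_iff hfin).2
    ⟨a, b, d, SimpleGraph.Walk.adj_toSubgraph_iff_mem_edges.2 ha,
      SimpleGraph.Walk.adj_toSubgraph_iff_mem_edges.2 hb,
      SimpleGraph.Walk.adj_toSubgraph_iff_mem_edges.2 hd, hab, had, hbd⟩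
  omega

/-- If all edges of a cycle but `uw` lie on another walk, then so does a second edge at `u`. -/
lemma exists_common_edge {v v' u w : V} {c : G.Walk v v} {c' : G.Walk v' v'} (hc : c.IsCycle)
    (he : {e | e ∈ c.edges} \ {e | e ∈ c'.edges} = {s(u, w)}) :
    ∃ x, x ≠ w ∧ s(u, x) ∈ c.edges ∧ s(u, x) ∈ c'.edges := by
  have hec : s(u, w) ∈ c.edges := ((Set.ext_iff.1 he _).2 rfl).1
  obtain ⟨x, hxw, hx⟩ := IsCycle.exists_edge_ne hc (w := w) (c.fst_mem_support_of_mem_edges hec)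
  refine ⟨x, hxw, hx, ?_⟩
  by_contra hcon
  exact hxw (Sym2.congr_right.1 ((Set.ext_iff.1 he _).1 ⟨hx, hcon⟩))

/-- A walk visiting both sides of a cut contains an edge of the cut. -/
lemma edges_inter_cut_nonempty {u w x y : V} {S : Set V} (p : G.Walk u w) (hx : x ∈ p.support)
    (hxS : x ∈ S) (hy : y ∈ p.support) (hyS : y ∉ S) : ({e | e ∈ p.edges} ∩ cut G S).Nonempty := by
  have key : ∀ z ∈ p.support, ¬(u ∈ S ↔ z ∈ S) → ({e | e ∈ p.edges} ∩ cut G S).Nonempty := by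
    intro z hz hne
    obtain ⟨k, rfl, hk⟩ := SimpleGraph.Walk.mem_support_iff_exists_getVert.1 hz
    have hk0 : 0 < k := by
      rcases Nat.eq_zero_or_pos k with rfl | h
      · simp at hne
      · exact h
    obtain ⟨i, -, hi, hc⟩ := exists_change (s := fun i => p.getVert i ∈ S) hk0 (by simpa using hne)
    refine ⟨_, ?_, mk_mem_cut.2 ⟨p.adj_getVert_succ (hi.trans_le hk), hc⟩⟩
    rw [← edges_getElem_eq_getVert p (by simpa using hi.trans_le hk)]
    exact List.getElem_mem _
  by_cases hu : u ∈ S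
  · exact key y hy (by tauto)
  · exact key x hx (by tauto)

/-- If all but one edge of a cycle lie on another cycle, then the latter has a further vertex. -/
lemma exists_vertex_notMem_support {v v' : V} {c : G.Walk v v} {c' : G.Walk v' v'}
    (hc : c.IsCycle) (hc' : c'.IsCycle) {e : Sym2 V}
    (he : {e | e ∈ c.edges} \ {e | e ∈ c'.edges} = {e}) : ∃ z ∈ c'.support, z ∉ c.support := by
  classical
  have hmem : ∀ f, f ∈ c.edges ∧ f ∉ c'.edges ↔ f = e := fun f => by
    simpa using Set.ext_iff.1 he f
  by_contra! hsub
  have hcard : #c'.edges.toFinset ≤ #c.edges.toFinset := by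
    rw [← card_support_toFinset hc, ← card_support_toFinset hc']
    exact card_le_card fun x hx => by simpa using hsub x (by simpa using hx)
  have h1 : #(c.edges.toFinset \ c'.edges.toFinset) ≤ 1 := by
    rw [card_le_one]
    intro a ha b hb
    rw [mem_sdiff, List.mem_toFinset, List.mem_toFinset, hmem] at ha hb
    rw [ha, hb]
  have h2 : #(c'.edges.toFinset \ c.edges.toFinset) ≤ 1 := by
    have := card_sdiff_add_card c.edges.toFinset c'.edges.toFinset
    have := card_sdiff_add_card c'.edges.toFinset c.edges.toFinset
    rw [union_comm] at this
    omega
  have new : ∀ u w, s(u, w) = e → ∃ y, y ≠ w ∧ s(u, y) ∈ c'.edges.toFinset \ c.edges.toFinset := by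
    intro u w huw
    obtain ⟨hec, hec'⟩ := (hmem _).2 huw
    obtain ⟨x, hxw, hx, hx'⟩ := exists_common_edge hc (huw ▸ he)
    obtain ⟨y, hyx, hy⟩ :=
      IsCycle.exists_edge_ne hc' (w := x) (c'.fst_mem_support_of_mem_edges hx')
    have hyw : y ≠ w := by
      rintro rfl
      exact hec' hy
    refine ⟨y, hyw, ?_⟩
    rw [mem_sdiff, List.mem_toFinset, List.mem_toFinset]
    exact ⟨hy, fun hyc => hyw (IsCycle.eq_of_mem_edges hc hx hyc hec hyx.symm hxw)⟩
  induction e with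
  | _ u w =>
    obtain ⟨y, hyw, hy⟩ := new u w rfl
    obtain ⟨z, hzu, hz⟩ := new w u Sym2.eq_swap
    have huw : u ≠ w := (c.adj_of_mem_edges ((hmem _).2 rfl).1).ne
    rcases Sym2.eq_iff.1 (card_le_one.1 h2 _ hy _ hz) with ⟨h, -⟩ | ⟨-, h⟩
    · exact huw h
    · exact hyw h

end Bonds

section Polytope

variable {G : SimpleGraph V}

/-- `x ↦ a^T x` as a linear map. -/
noncomputable def dotLinear {ι : Type*} [Fintype ι] (a : ι → ℝ) : (ι → ℝ) →ₗ[ℝ] ℝ where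
  toFun := dot a
  map_add' x y := by simp [dot, mul_add, Finset.sum_add_distrib]
  map_smul' r x := by simp [dot, Finset.mul_sum, mul_left_comm]

lemma dotLinear_apply {ι : Type*} [Fintype ι] (a x : ι → ℝ) : dotLinear a x = dot a x := rfl

/-- The coefficient vector of the cycle inequality of `c`. -/
def edgeVec [DecidableEq V] {v : V} (c : G.Walk v v) : ↥G.edgeSet → ℝ :=
  fun e => if (e : Sym2 V) ∈ c.edges then (1 : ℝ) else 0

lemma dot_edgeVec_indVec [DecidableEq V] [Fintype G.edgeSet] {v : V} (c : G.Walk v v)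
    (D : Set (Sym2 V)) :
    dot (edgeVec c) (indVec G D) = ({e | e ∈ c.edges} ∩ D).ncard := by
  classical
  have h1 : dot (edgeVec c) (indVec G D) =
      #{e : G.edgeSet | (e : Sym2 V) ∈ c.edges ∧ (e : Sym2 V) ∈ D} := by
    rw [card_filter, Nat.cast_sum]
    refine sum_congr rfl fun e _ => ?_
    by_cases h1 : (e : Sym2 V) ∈ c.edges <;> by_cases h2 : (e : Sym2 V) ∈ D <;>
      simp [edgeVec, indVec, h1, h2]
  have h2 : {e | e ∈ c.edges} ∩ D = ((↑) : G.edgeSet → Sym2 V) ''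
      (({e : G.edgeSet | (e : Sym2 V) ∈ c.edges ∧ (e : Sym2 V) ∈ D} : Finset G.edgeSet) :
        Set G.edgeSet) := by
    ext e
    simp only [Set.mem_inter_iff, Set.mem_ofPred_eq, coe_filter, mem_univ, true_and, Set.mem_image]
    constructor
    · exact fun h => ⟨⟨e, c.edges_subset_edgeSet h.1⟩, h, rfl⟩
    · rintro ⟨e, h, rfl⟩
      exact h
  rw [h1, h2, Set.ncard_image_of_injective _ Subtype.val_injective, Set.ncard_coe_finset]

lemma indVec_mem_bondPolytope_s14 {D : Set (Sym2 V)} (hD : IsBond G D) :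
    indVec G D ∈ bondPolytope G :=
  subset_convexHull ℝ _ ⟨D, hD, rfl⟩

/-- Linear inequalities valid for the bonds are valid for the bond polytope. -/
lemma le_of_mem_bondPolytope (f : (↥G.edgeSet → ℝ) →ₗ[ℝ] ℝ) {b : ℝ}
    (h : ∀ D, IsBond G D → f (indVec G D) ≤ b) {x : ↥G.edgeSet → ℝ} (hx : x ∈ bondPolytope G) :
    f x ≤ b := by
  refine convexHull_min (t := {x | f x ≤ b}) ?_ (convex_halfSpace_le f.isLinear b) hx
  rintro _ ⟨D, hD, rfl⟩
  exact h D hD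

/-- If the face `a^T x = b` satisfies a second equation `f x = b`, and `P` contains the origin
and a point distinguishing the two functionals, then the face is not a facet. -/
lemma not_isFacet_of_second_equation {ι : Type*} [Fintype ι] {P : Set (ι → ℝ)} {a : ι → ℝ} {b : ℝ}
    (hb : b ≠ 0) (h0 : (0 : ι → ℝ) ∈ P) (f : (ι → ℝ) →ₗ[ℝ] ℝ)
    (hf : ∀ x ∈ P, dot a x = b → f x = b) {y : ι → ℝ} (hy : y ∈ P) (hya : dot a y = 0)
    (hyf : f y ≠ 0) : ¬ IsFacet P a b := by
  rintro ⟨-, -, ⟨x, hxP, hx⟩, hdim⟩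
  set F := {x ∈ P | dot a x = b} with hF
  have hFa : vectorSpan ℝ F ≤ LinearMap.ker (dotLinear a) := by
    rw [vectorSpan_def, Submodule.span_le]
    rintro _ ⟨p, hp, q, hq, rfl⟩
    change dotLinear a (p - q) = 0
    rw [map_sub, dotLinear_apply, dotLinear_apply, hp.2, hq.2, sub_self]
  have hFf : vectorSpan ℝ F ≤ LinearMap.ker f := by
    rw [vectorSpan_def, Submodule.span_le]
    rintro _ ⟨p, hp, q, hq, rfl⟩
    simp [hf p hp.1 hp.2, hf q hq.1 hq.2]
  have hmem : ∀ z ∈ P, z ∈ vectorSpan ℝ P := fun z hz => by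
    simpa using vsub_mem_vectorSpan ℝ hz h0
  have hFP : vectorSpan ℝ F ≤ vectorSpan ℝ P := vectorSpan_mono ℝ fun z hz => hz.1
  have hlt1 : vectorSpan ℝ F < vectorSpan ℝ F ⊔ ℝ ∙ y := by
    refine lt_of_le_of_ne le_sup_left fun h => hyf ?_
    have : y ∈ vectorSpan ℝ F := by
      rw [h]
      exact Submodule.mem_sup_right (Submodule.mem_span_singleton_self y)
    exact hFf this
  have hlt2 : vectorSpan ℝ F ⊔ ℝ ∙ y < vectorSpan ℝ P := by
    refine lt_of_le_of_ne (sup_le hFP ((Submodule.span_singleton_le_iff_mem _ _).2 (hmem y hy)))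
      fun h => hb ?_
    have hker : vectorSpan ℝ F ⊔ ℝ ∙ y ≤ LinearMap.ker (dotLinear a) :=
      sup_le hFa ((Submodule.span_singleton_le_iff_mem _ _).2 hya)
    have : x ∈ LinearMap.ker (dotLinear a) := hker (h ▸ hmem x hxP)
    rw [← hx]
    exact this
  have := Submodule.finrank_lt_finrank_of_lt hlt1
  have := Submodule.finrank_lt_finrank_of_lt hlt2
  unfold affDim at hdim
  omega

end Polytope

theorem facet_implies_maximal_noninterleaved {V : Type*} [Fintype V] [DecidableEq V]
    (G : SimpleGraph V) [DecidableRel G.Adj] (hG : G.Connected)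
    (v : V) (c : G.Walk v v) (hc : c.IsCycle)
    (hfacet : IsFacet (bondPolytope G)
      (fun e => if (e : Sym2 V) ∈ c.edges then (1 : ℝ) else 0) 2) :
    ¬ IsInterleaved G c ∧
      ¬ ∃ (v' : V) (c' : G.Walk v' v'), c'.IsCycle ∧ ¬ IsInterleaved G c' ∧
        ({e | e ∈ c.edges} \ {e | e ∈ c'.edges}).ncard = 1 := by
  change IsFacet (bondPolytope G) (edgeVec c) 2 at hfacet
  have hni : ¬ IsInterleaved G c := by
    intro h
    obtain ⟨D, hD, hlt⟩ := exists_bond_two_lt_ncard hG hc h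
    have := hfacet.2.1 _ (indVec_mem_bondPolytope_s14 hD)
    rw [dot_edgeVec_indVec] at this
    exact absurd (by exact_mod_cast this) hlt.not_ge
  refine ⟨hni, ?_⟩
  rintro ⟨v', c', hc', hni', hcard⟩
  obtain ⟨e, he⟩ := Set.ncard_eq_one.1 hcard
  have hfin : ∀ D, ({e | e ∈ c'.edges} ∩ D).Finite := fun D =>
    (List.finite_toSet c'.edges).inter_of_left _
  have hupper : ∀ D, IsBond G D → ({e | e ∈ c'.edges} ∩ D).ncard ≤ 2 := by
    intro D hD
    rcases Set.eq_empty_or_nonempty ({e | e ∈ c'.edges} ∩ D) with h | h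
    · simp [h]
    · exact (ncard_edges_inter_eq_two hc' hni' hD h).le
  have hlower : ∀ D, IsBond G D →
      ({e | e ∈ c.edges} ∩ D).ncard ≤ ({e | e ∈ c'.edges} ∩ D).ncard := by
    intro D hD
    rcases Set.eq_empty_or_nonempty ({e | e ∈ c.edges} ∩ D) with h | h
    · simp [h]
    have h2 := ncard_edges_inter_eq_two hc hni hD h
    obtain ⟨f, hf, hfe⟩ := Set.exists_ne_of_one_lt_ncard (h2 ▸ one_lt_two) e
    have hf' : f ∈ c'.edges := by
      by_contra hcon
      exact hfe (Set.ext_iff.1 he f |>.1 ⟨hf.1, hcon⟩)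
    rw [h2, ncard_edges_inter_eq_two hc' hni' hD ⟨f, hf', hf.2⟩]
  have hface : ∀ x ∈ bondPolytope G, dot (edgeVec c) x = 2 → dotLinear (edgeVec c') x = 2 := by
    intro x hx hx2
    refine le_antisymm (le_of_mem_bondPolytope _ (fun D hD => ?_) hx) ?_
    · rw [dotLinear_apply, dot_edgeVec_indVec]
      exact_mod_cast hupper D hD
    · have := le_of_mem_bondPolytope (dotLinear (edgeVec c) - dotLinear (edgeVec c')) (b := 0)
        (fun D hD => ?_) hx
      · rw [LinearMap.sub_apply, dotLinear_apply, hx2] at this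
        linarith
      · rw [LinearMap.sub_apply, dotLinear_apply, dotLinear_apply, dot_edgeVec_indVec,
          dot_edgeVec_indVec, sub_nonpos]
        exact_mod_cast hlower D hD
  obtain ⟨z, hz', hz⟩ := exists_vertex_notMem_support hc hc' he
  obtain ⟨S, hzS, hSc, hS, hS'⟩ := exists_separating_preconnected hG (A := {z})
    (B := {x | x ∈ c.support}) SimpleGraph.Preconnected.of_subsingleton
    c.connected_induce_support.preconnected ⟨z, by simp⟩ (by simpa using hz)
  have hzero : (0 : ↥G.edgeSet → ℝ) ∈ bondPolytope G := by
    have : indVec G ∅ = 0 := by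
      ext
      simp [indVec]
    exact this ▸ indVec_mem_bondPolytope_s14 (isBond_empty hG)
  refine not_isFacet_of_second_equation two_ne_zero hzero _ hface
    (indVec_mem_bondPolytope_s14 ⟨S, rfl, hS, hS'⟩) ?_ ?_ hfacet
  · rw [dot_edgeVec_indVec, Nat.cast_eq_zero, Set.ncard_eq_zero
      ((List.finite_toSet c.edges).inter_of_left _), Set.eq_empty_iff_forall_notMem]
    rintro f ⟨hfc, -, a, b, rfl, ha, -⟩
    exact Set.disjoint_left.1 hSc ha (c.fst_mem_support_of_mem_edges hfc)
  · rw [dotLinear_apply, dot_edgeVec_indVec, Nat.cast_ne_zero]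
    refine (Set.ncard_pos (hfin _)).2 ?_ |>.ne'
    induction e with
    | _ u w =>
      obtain ⟨x, -, hx, hx'⟩ := exists_common_edge hc he
      exact edges_inter_cut_nonempty c' hz' (hzS rfl) (c'.fst_mem_support_of_mem_edges hx')
        fun hu => Set.disjoint_left.1 hSc hu (c.fst_mem_support_of_mem_edges hx)

end BondPolytope
end
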